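/- arXiv:2411.03977 — 2 statements merged into one kernel-verified Lean document; each statement's English description precedes it below -/
import Mathlib

section
/- Let u ∈ S², and let C ⊂ u^⊥ ⊂ R³ be a 2-dimensional convex body which is NOT a Cheeger set, i.e., there exists a 2-dimensional convex body B ⊂ C with H²(B)/H¹(∂B) > H²(C)/H¹(∂C). Then the convex body K = conv(C ∪ (B + u)) satisfies P_{u^⊥}(K) = C and (∫₀¹ H²((1-h)C + hB) dh)/(∫₀¹ H¹(∂((1-h)C + hB)) dh) > H²(C)/H¹(∂C). -/
open MeasureTheory Set Pointwise Filter
open scoped ENNReal RealInnerProductSpace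

noncomputable section

/-- Orthogonal projection onto the hyperplane `u^⊥` (for a unit vector `u`),
applied to a set. -/
def projPerp {n : ℕ} (u : EuclideanSpace ℝ (Fin n)) (S : Set (EuclideanSpace ℝ (Fin n))) :
    Set (EuclideanSpace ℝ (Fin n)) := (fun x => x - ⟪x, u⟫ • u) '' S

/-- Nonempty compact convex sets. -/
structure Bd {E : Type*} [AddCommGroup E] [Module ℝ E] [TopologicalSpace E] (K : Set E) : Prop where
  cpt : IsCompact K
  cvx : Convex ℝ K
  ne : K.Nonempty

theorem Bd.add {E : Type*} [NormedAddCommGroup E] [NormedSpace ℝ E] {K L : Set E}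
    (hK : Bd K) (hL : Bd L) : Bd (K + L) :=
  ⟨hK.cpt.add hL.cpt, hK.cvx.add hL.cvx, hK.ne.add hL.ne⟩

theorem Bd.smul {E : Type*} [NormedAddCommGroup E] [NormedSpace ℝ E] {K : Set E}
    (hK : Bd K) (c : ℝ) : Bd (c • K) :=
  ⟨hK.cpt.smul c, hK.cvx.smul c, hK.ne.smul_set⟩

theorem Bd.image {E F : Type*} [NormedAddCommGroup E] [NormedSpace ℝ E]
    [NormedAddCommGroup F] [NormedSpace ℝ F] {K : Set E}
    (hK : Bd K) (f : E →L[ℝ] F) : Bd (f '' K) :=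
  ⟨hK.cpt.image f.continuous, hK.cvx.is_linear_image f.isBoundedLinearMap.toIsLinearMap,
    hK.ne.image _⟩

theorem Bd.exists_Icc {K : Set ℝ} (hK : Bd K) : ∃ a b, a ≤ b ∧ K = Icc a b := by
  have hc : IsConnected K := ⟨hK.ne, hK.cvx.isPreconnected⟩
  have h := eq_Icc_of_connected_compact hc hK.cpt
  refine ⟨_, _, ?_, h⟩
  rw [h] at hc
  exact nonempty_Icc.1 hc.nonempty

theorem Icc_add_Icc_real {a b c d : ℝ} (hab : a ≤ b) (hcd : c ≤ d) :
    Icc a b + Icc c d = Icc (a + c) (b + d) := by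
  apply Subset.antisymm
  · rintro _ ⟨x, hx, y, hy, rfl⟩
    exact ⟨add_le_add hx.1 hy.1, add_le_add hx.2 hy.2⟩
  · rintro z ⟨h1, h2⟩
    by_cases h : z ≤ b + c
    · exact ⟨z - c, ⟨by linarith, by linarith⟩, c, ⟨le_rfl, hcd⟩, by simp⟩
    · exact ⟨b, ⟨hab, le_rfl⟩, z - b, ⟨by linarith, by linarith⟩, by simp⟩

theorem Bd.volume_add {K L : Set ℝ} (hK : Bd K) (hL : Bd L) :
    volume (K + L) = volume K + volume L := by
  obtain ⟨a, b, hab, rfl⟩ := hK.exists_Icc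
  obtain ⟨c, d, hcd, rfl⟩ := hL.exists_Icc
  rw [Icc_add_Icc_real hab hcd, Real.volume_Icc, Real.volume_Icc, Real.volume_Icc,
    ← ENNReal.ofReal_add (by linarith) (by linarith)]
  congr 1; ring

theorem Bd.slice {K : Set (ℝ × ℝ)} (hK : Bd K) {x : ℝ} (hx : x ∈ Prod.fst '' K) :
    Bd (Prod.mk x ⁻¹' K) := by
  refine ⟨?_, ?_, ?_⟩
  · have : Prod.mk x ⁻¹' K = Prod.snd '' (K ∩ {p | p.1 = x}) := by
      ext y; constructor
      · intro h; exact ⟨(x, y), ⟨h, rfl⟩, rfl⟩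
      · rintro ⟨⟨p, q⟩, ⟨h1, h2⟩, rfl⟩
        simp only [mem_ofPred_eq] at h2; subst h2; exact h1
    rw [this]
    exact (hK.cpt.inter_right (isClosed_eq continuous_fst continuous_const)).image continuous_snd
  · intro y hy z hz a b ha hb hab
    have := hK.cvx hy hz ha hb hab
    simp only [Prod.smul_mk, Prod.mk_add_mk] at this
    rw [← add_smul, hab, one_smul] at this
    exact this
  · obtain ⟨⟨p, q⟩, h, rfl⟩ := hx
    exact ⟨q, h⟩

theorem slice_empty {K : Set (ℝ × ℝ)} {x : ℝ} (hx : x ∉ Prod.fst '' K) :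
    Prod.mk x ⁻¹' K = ∅ := by
  ext y
  simp only [mem_preimage, mem_empty_iff_false, iff_false]
  intro h; exact hx ⟨_, h, rfl⟩

theorem seg_prod {K : Set (ℝ × ℝ)} (hK : Bd K) {c : ℝ} (hc : 0 ≤ c) :
    volume (K + ({0} : Set ℝ) ×ˢ Icc 0 c) = volume K + ENNReal.ofReal c * volume (Prod.fst '' K) := by
  have hS : Bd (({0} : Set ℝ) ×ˢ Icc 0 c) :=
    ⟨isCompact_singleton.prod isCompact_Icc, (convex_singleton 0).prod (convex_Icc 0 c),
      (singleton_nonempty 0).prod (nonempty_Icc.2 hc)⟩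
  have hI : Bd (Icc 0 c) := ⟨isCompact_Icc, convex_Icc 0 c, nonempty_Icc.2 hc⟩
  have hm1 : MeasurableSet K := hK.cpt.measurableSet
  have hm2 : MeasurableSet (K + ({0} : Set ℝ) ×ˢ Icc 0 c) := (hK.add hS).cpt.measurableSet
  have hm3 : MeasurableSet (Prod.fst '' K) := (hK.cpt.image continuous_fst).measurableSet
  have key : ∀ x, volume (Prod.mk x ⁻¹' (K + ({0} : Set ℝ) ×ˢ Icc 0 c)) =
      volume (Prod.mk x ⁻¹' K) + (Prod.fst '' K).indicator (fun _ => ENNReal.ofReal c) x := by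
    intro x
    have h1 : Prod.mk x ⁻¹' (K + ({0} : Set ℝ) ×ˢ Icc 0 c) = Prod.mk x ⁻¹' K + Icc 0 c := by
      ext y; constructor
      · rintro ⟨⟨p, q⟩, hp, ⟨r, s⟩, ⟨hr, hs⟩, h⟩
        simp only [mem_singleton_iff] at hr
        simp only [Prod.mk_add_mk, Prod.mk.injEq] at h
        subst hr
        obtain ⟨h, h'⟩ := h
        refine ⟨q, ?_, s, hs, h'⟩
        simp only [add_zero] at h; subst h; exact hp
      · rintro ⟨q, hq, s, hs, rfl⟩
        exact ⟨(x, q), hq, (0, s), ⟨rfl, hs⟩, by simp⟩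
    rw [h1]
    by_cases hx : x ∈ Prod.fst '' K
    · rw [(hK.slice hx).volume_add hI, indicator_of_mem hx, Real.volume_Icc, sub_zero]
    · rw [slice_empty hx, indicator_of_notMem hx]; simp
  rw [Measure.volume_eq_prod, Measure.prod_apply hm2, Measure.prod_apply hm1]
  simp_rw [key]
  rw [lintegral_add_left (measurable_measure_prodMk_left hm1), lintegral_indicator_const hm3]

theorem lintegral_affine (f : ℝ → ℝ≥0∞) (hf : Measurable f) (a : ℝ) {w : ℝ} (hw : 0 < w) :
    ∫⁻ x, f x = ENNReal.ofReal w * ∫⁻ t, f (a + w * t) := by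
  rw [← lintegral_add_left_eq_self f a]
  have h := Real.smul_map_volume_mul_left hw.ne'
  conv_lhs => rw [← h]
  rw [lintegral_smul_measure, lintegral_map (by fun_prop) (by fun_prop), abs_of_pos hw]
  rfl

theorem bm_prod {K L : Set (ℝ × ℝ)} (hK : Bd K) (hL : Bd L)
    {a b w z : ℝ} (hw : 0 < w) (hz : 0 < z) (hKa : Prod.fst '' K = Icc a (a + w))
    (hLb : Prod.fst '' L = Icc b (b + z)) :
    ENNReal.ofReal (w + z) * (volume K / ENNReal.ofReal w + volume L / ENNReal.ofReal z)
      ≤ volume (K + L) := by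
  have hm1 : MeasurableSet K := hK.cpt.measurableSet
  have hm2 : MeasurableSet L := hL.cpt.measurableSet
  have hm3 : MeasurableSet (K + L) := (hK.add hL).cpt.measurableSet
  rw [Measure.volume_eq_prod, Measure.prod_apply hm1, Measure.prod_apply hm2,
    Measure.prod_apply hm3]
  have e1 := measurable_measure_prodMk_left (ν := (volume : Measure ℝ)) hm1
  have e2 := measurable_measure_prodMk_left (ν := (volume : Measure ℝ)) hm2
  have e3 := measurable_measure_prodMk_left (ν := (volume : Measure ℝ)) hm3
  rw [lintegral_affine _ e1 a hw, lintegral_affine _ e2 b hz,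
    lintegral_affine _ e3 (a + b) (add_pos hw hz)]
  have c1 : ENNReal.ofReal w ≠ 0 := by simpa using hw
  have c2 : ENNReal.ofReal z ≠ 0 := by simpa using hz
  rw [mul_comm (ENNReal.ofReal w), mul_comm (ENNReal.ofReal z),
    ENNReal.mul_div_cancel_right c1 ENNReal.ofReal_ne_top,
    ENNReal.mul_div_cancel_right c2 ENNReal.ofReal_ne_top]
  gcongr
  have e1' : Measurable fun t : ℝ => volume (Prod.mk (a + w * t) ⁻¹' K) :=
    e1.comp (by fun_prop : Measurable fun t : ℝ => a + w * t)
  rw [← lintegral_add_left e1']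
  apply lintegral_mono
  intro t
  simp only
  by_cases ht : 0 ≤ t ∧ t ≤ 1
  · have m1 : a + w * t ∈ Prod.fst '' K := by
      rw [hKa]; constructor <;> nlinarith
    have m2 : b + z * t ∈ Prod.fst '' L := by
      rw [hLb]; constructor <;> nlinarith
    rw [← (hK.slice m1).volume_add (hL.slice m2)]
    apply measure_mono
    rintro _ ⟨p, hp, q, hq, rfl⟩
    refine ⟨_, hp, _, hq, ?_⟩
    simp only [Prod.mk_add_mk, Prod.mk.injEq, and_true]
    ring
  · have m1 : a + w * t ∉ Prod.fst '' K := by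
      rw [hKa]; rintro ⟨h1, h2⟩; apply ht; constructor <;> nlinarith
    have m2 : b + z * t ∉ Prod.fst '' L := by
      rw [hLb]; rintro ⟨h1, h2⟩; apply ht; constructor <;> nlinarith
    rw [slice_empty m1, slice_empty m2]; simp


/-- Area in the complex plane. -/
def Ar (S : Set ℂ) : ℝ := volume.real S

/-- The functional `x ↦ det (v, x)`. -/
def fv (v : ℂ) : ℂ →L[ℝ] ℝ :=
  Complex.imCLM.comp (ContinuousLinearMap.mul ℝ ℂ (starRingEnd ℂ v))

theorem fv_apply (v x : ℂ) : fv v x = v.re * x.im - v.im * x.re := by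
  simp [fv]; ring

/-- Length of the image of `K` under `det (v, ·)`. -/
def Wd (v : ℂ) (K : Set ℂ) : ℝ := volume.real (fv v '' K)

theorem Wd_nonneg (v : ℂ) (K : Set ℂ) : 0 ≤ Wd v K := measureReal_nonneg

theorem Ar_nonneg (K : Set ℂ) : 0 ≤ Ar K := measureReal_nonneg

theorem Wd_add (v : ℂ) {K L : Set ℂ} (hK : Bd K) (hL : Bd L) :
    Wd v (K + L) = Wd v K + Wd v L := by
  unfold Wd
  rw [image_add, measureReal_def, (hK.image (fv v)).volume_add (hL.image (fv v)),
    ENNReal.toReal_add (hK.image (fv v)).cpt.measure_ne_top (hL.image (fv v)).cpt.measure_ne_top]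
  rfl

theorem Wd_smul (v : ℂ) (K : Set ℂ) {c : ℝ} (hc : 0 ≤ c) :
    Wd v (c • K) = c * Wd v K := by
  unfold Wd
  rw [image_smul_set, measureReal_def, Measure.addHaar_smul]
  simp [measureReal_def, abs_of_nonneg hc, ENNReal.toReal_ofReal hc]

theorem Wd_mono (v : ℂ) {K L : Set ℂ} (hL : IsCompact L) (h : K ⊆ L) : Wd v K ≤ Wd v L := by
  unfold Wd
  exact measureReal_mono (image_mono h) (hL.image (fv v).continuous).measure_ne_top

theorem Ar_smul (K : Set ℂ) (c : ℝ) : Ar (c • K) = c ^ 2 * Ar K := by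
  unfold Ar
  rw [measureReal_def, Measure.addHaar_smul]
  simp [measureReal_def, sq_nonneg]

theorem Ar_eq_prod (S : Set ℂ) :
    volume S = volume (Complex.equivRealProdCLM '' S) := by
  have h := Complex.volume_preserving_equiv_real_prod.symm.measure_preimage_equiv S
  rw [← h]
  congr 1
  ext x
  constructor
  · intro hx; exact ⟨_, hx, by ext <;> simp [Complex.measurableEquivRealProd] ⟩
  · rintro ⟨y, hy, rfl⟩
    have e : Complex.measurableEquivRealProd.symm (Complex.equivRealProdCLM y) = y := by
      apply Complex.ext <;> rfl
    rw [mem_preimage, e]; exact hy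

theorem Ar_isom (Φ : ℂ ≃ₗᵢ[ℝ] ℂ) (S : Set ℂ) : volume (Φ '' S) = volume S := by
  rw [Φ.image_eq_preimage_symm]
  exact (Φ.symm.measurePreserving).measure_preimage_equiv (f := Φ.symm.toMeasurableEquiv) S

theorem bd_segment (v : ℂ) : Bd (segment ℝ 0 v) := by
  refine ⟨?_, convex_segment _ _, ⟨0, left_mem_segment _ _ _⟩⟩
  rw [segment_eq_image]
  exact isCompact_Icc.image (by fun_prop)

theorem seg_image (r : ℝ) (hr : 0 ≤ r) :
    Complex.equivRealProdCLM '' (segment ℝ (0:ℂ) (Complex.I * r)) = ({0} : Set ℝ) ×ˢ Icc 0 r := by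
  ext ⟨x, y⟩
  simp only [segment_eq_image, mem_image, mem_prod, mem_singleton_iff, mem_Icc]
  constructor
  · rintro ⟨_, ⟨t, ⟨h0, h1⟩, rfl⟩, h⟩
    simp at h
    obtain ⟨rfl, rfl⟩ := h
    exact ⟨rfl, by positivity, by nlinarith⟩
  · rintro ⟨rfl, h0, h1⟩
    rcases hr.eq_or_lt with rfl | hr
    · obtain rfl : y = 0 := le_antisymm h1 h0
      refine ⟨_, ⟨0, by simp, rfl⟩, by simp⟩
    · refine ⟨_, ⟨y / r, ⟨by positivity, (div_le_one hr).2 h1⟩, rfl⟩, ?_⟩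
      simp [hr.ne']

theorem Ar_seg {K : Set ℂ} (hK : Bd K) (v : ℂ) :
    Ar (K + segment ℝ 0 v) = Ar K + Wd v K := by
  by_cases hv : v = 0
  · subst hv
    have : Wd 0 K = 0 := by
      unfold Wd
      have : fv 0 '' K ⊆ {0} := by
        rintro _ ⟨x, -, rfl⟩; simp [fv_apply]
      have h2 := measure_mono (μ := volume) this
      simp at h2
      rw [measureReal_def, h2]; rfl
    rw [this, segment_same]; simp
  have hr : 0 < ‖v‖ := norm_pos_iff.2 hv
  let c : Circle := ⟨Complex.I * (v / ‖v‖), by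
    change _ ∈ Metric.sphere (0 : ℂ) 1
    rw [mem_sphere_zero_iff_norm]; simp [hr.ne']⟩
  let Φ : ℂ ≃ₗᵢ[ℝ] ℂ := Complex.conjLIE.trans (rotation c)
  have hΦ : ∀ x, Φ x = Complex.I * (v / ‖v‖) * (starRingEnd ℂ x) := fun x => by
    rfl
  have hΦv : Φ v = Complex.I * (‖v‖ : ℝ) := by
    rw [hΦ, mul_assoc]; congr 1
    rw [div_mul_eq_mul_div, Complex.mul_conj, Complex.normSq_eq_norm_sq]
    have : (‖v‖ : ℂ) ≠ 0 := by exact_mod_cast hr.ne'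
    push_cast; field_simp
  have hre : ∀ x, fv v x = ‖v‖ * (Φ x).re := fun x => by
    rw [hΦ, fv_apply]
    have : Complex.I * (v / ‖v‖) * (starRingEnd ℂ x)
      = ((‖v‖⁻¹ : ℝ) : ℂ) * (Complex.I * v * (starRingEnd ℂ x)) := by
        push_cast; rw [div_eq_mul_inv]; ring
    rw [this, Complex.re_ofReal_mul, ← mul_assoc, mul_inv_cancel₀ hr.ne']
    simp
    ring
  let Ψ : ℂ →L[ℝ] ℝ × ℝ :=
    (Complex.equivRealProdCLM : ℂ →L[ℝ] ℝ × ℝ).comp (Φ.toContinuousLinearEquiv : ℂ →L[ℝ] ℂ)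
  have hvol : ∀ S, volume S = volume (Ψ '' S) := fun S => by
    rw [← Ar_isom Φ S, Ar_eq_prod, image_image]; rfl
  have hseg : Ψ '' (segment ℝ 0 v) = ({0} : Set ℝ) ×ˢ Icc 0 ‖v‖ := by
    rw [← seg_image ‖v‖ hr.le, ← hΦv]
    have : Φ '' (segment ℝ 0 v) = segment ℝ 0 (Φ v) := by
      have := image_segment ℝ (Φ.toLinearEquiv.toLinearMap.toAffineMap) 0 v
      simpa using this
    rw [← this, image_image]; rfl
  unfold Ar
  rw [measureReal_def, hvol, image_add, hseg, seg_prod (hK.image Ψ) hr.le, ← hvol,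
    ENNReal.toReal_add hK.cpt.measure_ne_top (ENNReal.mul_ne_top ENNReal.ofReal_ne_top
      ((hK.image Ψ).cpt.image continuous_fst).measure_ne_top)]
  rw [measureReal_def]
  congr 1
  have : fv v '' K = ‖v‖ • (Prod.fst '' (Ψ '' K)) := by
    rw [← image_smul, image_image, image_image]
    apply image_congr
    intro x _
    rw [hre]; rfl
  unfold Wd
  rw [this, measureReal_def, Measure.addHaar_smul]
  simp

theorem re_width {K : Set ℂ} (hK : Bd K) (hi : (interior K).Nonempty) :
    ∃ a w, 0 < w ∧ Prod.fst '' (Complex.equivRealProdCLM '' K) = Icc a (a + w) := by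
  have hb : Bd (Prod.fst '' (Complex.equivRealProdCLM '' K)) := by
    have := (hK.image (Complex.equivRealProdCLM : ℂ →L[ℝ] ℝ × ℝ)).image
      (ContinuousLinearMap.fst ℝ ℝ ℝ)
    simpa using this
  obtain ⟨a, b, hab, h⟩ := hb.exists_Icc
  refine ⟨a, b - a, ?_, by rw [h]; simp⟩
  obtain ⟨x, hx⟩ := hi
  obtain ⟨δ, hδ, hball⟩ := Metric.isOpen_iff.1 isOpen_interior x hx
  have hy : x + ((δ / 2 : ℝ) : ℂ) ∈ K := by
    apply interior_subset; apply hball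
    rw [Metric.mem_ball, dist_eq_norm]
    simp [abs_of_pos hδ]; exact hδ
  have m1 : x.re ∈ Icc a b := by
    rw [← h]; exact ⟨_, ⟨x, interior_subset hx, rfl⟩, rfl⟩
  have m2 : x.re + δ / 2 ∈ Icc a b := by
    rw [← h]; exact ⟨_, ⟨_, hy, rfl⟩, by simp⟩
  have := m1.1; have := m2.2
  linarith

theorem Ar_bm {K L : Set ℂ} (hK : Bd K) (hL : Bd L)
    (hKi : (interior K).Nonempty) (hLi : (interior L).Nonempty) :
    Ar K + Ar L + 2 * √(Ar K * Ar L) ≤ Ar (K + L) := by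
  obtain ⟨a, w, hw, h1⟩ := re_width hK hKi
  obtain ⟨b, z, hz, h2⟩ := re_width hL hLi
  have h := bm_prod (hK.image (Complex.equivRealProdCLM : ℂ →L[ℝ] ℝ × ℝ))
    (hL.image (Complex.equivRealProdCLM : ℂ →L[ℝ] ℝ × ℝ)) hw hz h1 h2
  rw [← image_add] at h
  have e : ∀ S, volume ((Complex.equivRealProdCLM : ℂ →L[ℝ] ℝ × ℝ) '' S) = volume S :=
    fun S => (Ar_eq_prod S).symm
  rw [e, e, e] at h
  have h' := ENNReal.toReal_mono (hK.add hL).cpt.measure_ne_top h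
  rw [ENNReal.toReal_mul, ENNReal.toReal_add
    (ENNReal.div_ne_top hK.cpt.measure_ne_top (by simpa using hw))
    (ENNReal.div_ne_top hL.cpt.measure_ne_top (by simpa using hz)),
    ENNReal.toReal_div, ENNReal.toReal_div, ENNReal.toReal_ofReal hw.le,
    ENNReal.toReal_ofReal hz.le, ENNReal.toReal_ofReal (by positivity)] at h'
  change (w + z) * (Ar K / w + Ar L / z) ≤ Ar (K + L) at h'
  refine le_trans ?_ h'
  have hk := Ar_nonneg K
  have hl := Ar_nonneg L
  have e1 : (w + z) * (Ar K / w + Ar L / z) = Ar K + Ar L + (z / w * Ar K + w / z * Ar L) := by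
    field_simp; ring
  rw [e1]
  have e2 : Ar K * Ar L = (z / w * Ar K) * (w / z * Ar L) := by field_simp
  have p1 : 0 ≤ z / w * Ar K := by positivity
  have p2 : 0 ≤ w / z * Ar L := by positivity
  rw [e2, Real.sqrt_mul p1]
  nlinarith [sq_nonneg (√(z / w * Ar K) - √(w / z * Ar L)), Real.sq_sqrt p1, Real.sq_sqrt p2]


/-- The functional `2 V(·, Z)` for the zonotope `Z` spanned by `v 0, …, v (n-1)`. -/
def pz (v : ℕ → ℂ) (n : ℕ) (K : Set ℂ) : ℝ := ∑ k ∈ Finset.range n, Wd (v k) K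

/-- The zonotope. -/
def zon (v : ℕ → ℂ) (n : ℕ) : Set ℂ := ∑ k ∈ Finset.range n, segment ℝ 0 (v k)

theorem zon_succ (v : ℕ → ℂ) (n : ℕ) : zon v (n + 1) = zon v n + segment ℝ 0 (v n) :=
  Finset.sum_range_succ _ _

theorem pz_succ (v : ℕ → ℂ) (n : ℕ) (K : Set ℂ) : pz v (n + 1) K = pz v n K + Wd (v n) K :=
  Finset.sum_range_succ _ _

theorem bd_zon (v : ℕ → ℂ) (n : ℕ) : Bd (zon v n) := by
  induction n with
  | zero =>
    have : zon v 0 = {0} := by simp [zon]; rfl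
    rw [this]
    exact ⟨isCompact_singleton, convex_singleton 0, singleton_nonempty 0⟩
  | succ n ih => rw [zon_succ]; exact ih.add (bd_segment _)

theorem Ar_zon (v : ℕ → ℂ) (n : ℕ) {K : Set ℂ} (hK : Bd K) :
    Ar (K + zon v n) = Ar K + pz v n K + Ar (zon v n) := by
  induction n with
  | zero =>
    have : zon v 0 = {0} := by simp [zon]; rfl
    rw [this]
    simp [pz, Ar, measureReal_def]
  | succ n ih =>
    rw [zon_succ, ← add_assoc, Ar_seg (hK.add (bd_zon v n)), ih, Ar_seg (bd_zon v n),
      Wd_add _ hK (bd_zon v n), pz_succ]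
    ring

theorem pz_add (v : ℕ → ℂ) (n : ℕ) {K L : Set ℂ} (hK : Bd K) (hL : Bd L) :
    pz v n (K + L) = pz v n K + pz v n L := by
  unfold pz
  rw [← Finset.sum_add_distrib]
  exact Finset.sum_congr rfl fun k _ => Wd_add _ hK hL

theorem pz_smul (v : ℕ → ℂ) (n : ℕ) (K : Set ℂ) {c : ℝ} (hc : 0 ≤ c) :
    pz v n (c • K) = c * pz v n K := by
  unfold pz
  rw [Finset.mul_sum]
  exact Finset.sum_congr rfl fun k _ => Wd_smul _ _ hc

theorem pz_mono (v : ℕ → ℂ) (n : ℕ) {K L : Set ℂ} (hL : IsCompact L) (h : K ⊆ L) :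
    pz v n K ≤ pz v n L :=
  Finset.sum_le_sum fun _ _ => Wd_mono _ hL h

theorem Ar_zon_t (v : ℕ → ℂ) (n : ℕ) {K : Set ℂ} (hK : Bd K) {t : ℝ} (ht : 0 < t) :
    Ar (K + t • zon v n) = Ar K + t * pz v n K + t ^ 2 * Ar (zon v n) := by
  have h1 : K + t • zon v n = t • (t⁻¹ • K + zon v n) := by
    rw [smul_add, smul_smul, mul_inv_cancel₀ ht.ne', one_smul]
  rw [h1, Ar_smul, Ar_zon _ _ (hK.smul _), Ar_smul, pz_smul _ _ _ (by positivity)]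
  field_simp

theorem sqrt_aux {a b X : ℝ} (ha : 0 ≤ a) (hb : 0 ≤ b) (hX : 0 < X) :
    X + (a + b) / 2 - (a - b) ^ 2 / (4 * X) ≤ √((a + X) * (b + X)) := by
  set m := X + (a + b) / 2 with hm
  have hm0 : 0 < m := by positivity
  have hXm : X ≤ m := by linarith
  have h1 : m - (a - b) ^ 2 / (4 * X) ≤ m - (a - b) ^ 2 / (4 * m) := by
    gcongr
  refine h1.trans (Real.le_sqrt_of_sq_le ?_)
  have h2 : (a + X) * (b + X) = m ^ 2 - (a - b) ^ 2 / 4 := by rw [hm]; ring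
  rw [h2]
  set e := (a - b) ^ 2 / (4 * m) with he
  have h3 : (a - b) ^ 2 / 4 = m * e := by rw [he]; field_simp
  have he0 : 0 ≤ e := by positivity
  have h4 : e ≤ m := by
    have : m * e ≤ m * m := by rw [← h3, hm]; nlinarith [mul_nonneg ha hb]
    exact le_of_mul_le_mul_left this hm0
  rw [h3]
  nlinarith

theorem main_Z (v : ℕ → ℂ) (n : ℕ) {C B : Set ℂ} (hC : Bd C) (hB : Bd B)
    (hCi : (interior C).Nonempty) (hBi : (interior B).Nonempty)
    (p0 : 0 < pz v n C) (p1 : 0 < pz v n B) :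
    (pz v n C + pz v n B) * (Ar C / pz v n C + Ar B / pz v n B) ≤ Ar (C + B) := by
  set p := pz v n C with hp
  set q := pz v n B with hq
  set α := Ar C / p ^ 2 with hα
  set β := Ar B / q ^ 2 with hβ
  have hα0 : 0 ≤ α := div_nonneg (Ar_nonneg _) (by positivity)
  have hβ0 : 0 ≤ β := div_nonneg (Ar_nonneg _) (by positivity)
  have hAC : Ar C = p ^ 2 * α := by rw [hα]; field_simp
  have hAB : Ar B = q ^ 2 * β := by rw [hβ]; field_simp
  set c := p * q * (α - β) ^ 2 / 2 with hc
  have hc0 : 0 ≤ c := by positivity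
  have hZ := bd_zon v n
  have key : ∀ t : ℝ, 0 < t → p ^ 2 * α + q ^ 2 * β + p * q * (α + β) - c / t ≤ Ar (C + B) := by
    intro t ht
    have hK := hC.add (hZ.smul (p * t))
    have hL := hB.add (hZ.smul (q * t))
    have hKi : (interior (C + (p * t) • zon v n)).Nonempty :=
      (hCi.add (hZ.smul (p * t)).ne).mono subset_interior_add_left
    have hLi : (interior (B + (q * t) • zon v n)).Nonempty :=
      (hBi.add (hZ.smul (q * t)).ne).mono subset_interior_add_left
    have h := Ar_bm hK hL hKi hLi
    have e : C + (p * t) • zon v n + (B + (q * t) • zon v n) =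
        (C + B) + ((p + q) * t) • zon v n := by
      rw [add_mul, hZ.cvx.add_smul (by positivity) (by positivity)]
      abel
    rw [e, Ar_zon_t _ _ hC (by positivity), Ar_zon_t _ _ hB (by positivity),
      Ar_zon_t _ _ (hC.add hB) (by positivity), pz_add _ _ hC hB, ← hp, ← hq] at h
    set a := Ar (zon v n) with ha
    have ha0 : 0 ≤ a := Ar_nonneg _
    set X := t + a * t ^ 2 with hX
    have hXt : t ≤ X := by rw [hX]; nlinarith [mul_nonneg ha0 (sq_nonneg t)]
    have hX0 : 0 < X := by linarith
    have e1 : Ar C + p * t * p + (p * t) ^ 2 * a = p ^ 2 * (α + X) := by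
      rw [hAC, hX]; ring
    have e2 : Ar B + q * t * q + (q * t) ^ 2 * a = q ^ 2 * (β + X) := by
      rw [hAB, hX]; ring
    have e3 : p ^ 2 * (α + X) * (q ^ 2 * (β + X)) = (p * q) ^ 2 * ((α + X) * (β + X)) := by ring
    rw [e1, e2, e3, Real.sqrt_mul (by positivity), Real.sqrt_sq (by positivity)] at h
    have h5 := sqrt_aux hα0 hβ0 hX0
    have h6 : (α - β) ^ 2 / (4 * X) ≤ (α - β) ^ 2 / (4 * t) := by gcongr
    have h7 : X + (α + β) / 2 - (α - β) ^ 2 / (4 * t) ≤ √((α + X) * (β + X)) := by linarith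
    have h8 := mul_le_mul_of_nonneg_left h7 (by positivity : 0 ≤ 2 * (p * q))
    have e4 : c / t = 2 * (p * q) * ((α - β) ^ 2 / (4 * t)) := by rw [hc]; field_simp; ring
    have e5 : Ar (C + B) + (p + q) * t * (p + q) + ((p + q) * t) ^ 2 * a
      = Ar (C + B) + (p + q) ^ 2 * X := by rw [hX]; ring
    rw [e5] at h
    rw [e4]
    nlinarith
  have e6 : (p + q) * (Ar C / p + Ar B / q) = p ^ 2 * α + q ^ 2 * β + p * q * (α + β) := by
    rw [hAC, hAB]; field_simp; ring
  rw [e6]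
  by_contra! hlt
  set S := p ^ 2 * α + q ^ 2 * β + p * q * (α + β)
  have hd : 0 < S - Ar (C + B) := by linarith
  have h := key ((c + 1) / (S - Ar (C + B))) (by positivity)
  have : c / ((c + 1) / (S - Ar (C + B))) < S - Ar (C + B) := by
    rw [div_div_eq_mul_div, div_lt_iff₀ (by positivity)]
    nlinarith
  linarith


/-- Perimeter. -/
def Pr (K : Set ℂ) : ℝ≥0∞ := μH[1] (frontier K)

theorem Pr_smul (K : Set ℂ) {c : ℝ} (hc : 0 < c) : Pr (c • K) = ENNReal.ofReal c * Pr K := by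
  unfold Pr
  have h := (Homeomorph.smulOfNeZero (α := ℂ) c hc.ne').image_frontier K
  have e : ∀ S : Set ℂ, (Homeomorph.smulOfNeZero (α := ℂ) c hc.ne') '' S = c • S := fun S => rfl
  rw [e, e] at h
  rw [← h, Measure.hausdorffMeasure_smul₀ zero_le_one hc.ne', NNReal.rpow_one, ENNReal.smul_def,
    smul_eq_mul]
  congr 1
  rw [← ENNReal.ofReal_coe_nnreal]
  congr 1
  simp [abs_of_pos hc]

theorem exists_ray_frontier {L : Set ℂ} (hL : IsCompact L) {x n : ℂ} (hx : x ∈ L) (hn : n ≠ 0) :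
    ∃ s : ℝ, 0 ≤ s ∧ x + s • n ∈ frontier L := by
  by_contra! hcon
  have hpre : IsPreconnected ((fun s : ℝ => x + s • n) '' Ici 0) :=
    (convex_Ici (0:ℝ)).isPreconnected.image _ (by fun_prop)
  have hfr : frontier L = L \ interior L := hL.isClosed.frontier_eq
  obtain ⟨R, hR⟩ := hL.isBounded.subset_closedBall x
  have hn0 : 0 < ‖n‖ := norm_pos_iff.2 hn
  have := hpre (interior L) Lᶜ isOpen_interior hL.isClosed.isOpen_compl ?_ ?_ ?_
  · obtain ⟨y, -, h1, h2⟩ := this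
    exact h2 (interior_subset h1)
  · rintro _ ⟨s, hs, rfl⟩
    by_cases h : x + s • n ∈ L
    · left
      have := hcon s hs
      rw [hfr] at this
      by_contra h'
      exact this ⟨h, h'⟩
    · right; exact h
  · refine ⟨x, ⟨0, by simp, by simp⟩, ?_⟩
    have := hcon 0 le_rfl
    rw [hfr] at this
    by_contra h'
    apply this
    simpa using ⟨hx, h'⟩
  · refine ⟨x + ((|R| + 1) / ‖n‖) • n, ⟨(|R| + 1) / ‖n‖, by simp; positivity, rfl⟩, ?_⟩
    intro h
    have h2 := hR h
    rw [Metric.mem_closedBall, dist_eq_norm, add_sub_cancel_left, norm_smul, Real.norm_eq_abs,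
      abs_of_nonneg (by positivity), div_mul_cancel₀ _ hn0.ne'] at h2
    linarith [le_abs_self R]

theorem exists_normal {K : Set ℂ} (hK : Convex ℝ K) (hi : (interior K).Nonempty) {x : ℂ}
    (hx : x ∈ frontier K) : ∃ n : ℂ, n ≠ 0 ∧ ∀ k ∈ K, ⟪n, k - x⟫ ≤ 0 := by
  obtain ⟨f, hf⟩ := geometric_hahn_banach_open_point hK.interior isOpen_interior hx.2
  refine ⟨(InnerProductSpace.toDual ℝ ℂ).symm f, ?_, ?_⟩
  · intro h
    obtain ⟨y, hy⟩ := hi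
    have h0 : f = 0 := by simpa using h
    have := hf y hy
    simp [h0] at this
  · intro k hk
    rw [InnerProductSpace.toDual_symm_apply, map_sub, sub_nonpos]
    have hk' : k ∈ closure (interior K) := by
      rw [hK.closure_interior_eq_closure_of_nonempty_interior hi]; exact subset_closure hk
    exact closure_minimal (fun a ha => (hf a ha).le)
      (isClosed_le f.continuous continuous_const : IsClosed {a | f a ≤ f x}) hk'

theorem Pr_mono {K L : Set ℂ} (hK : Convex ℝ K) (hKc : IsClosed K) (hi : (interior K).Nonempty)
    (hL : IsCompact L) (h : K ⊆ L) : Pr K ≤ Pr L := by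
  have H : ∀ x : frontier K, ∃ n : ℂ, ∃ s : ℝ, 0 ≤ s ∧ x + s • n ∈ frontier L ∧
      ∀ k ∈ K, ⟪n, k - x⟫ ≤ 0 := by
    rintro ⟨x, hx⟩
    obtain ⟨n, hn, hk⟩ := exists_normal hK hi hx
    obtain ⟨s, hs, hs'⟩ := exists_ray_frontier hL (h (hKc.frontier_subset hx)) hn
    exact ⟨n, s, hs, hs', hk⟩
  choose n s hs hfr hn using H
  let g : frontier K → ℂ := fun x => x + s x • n x
  have hg : AntilipschitzWith 1 g := by
    apply AntilipschitzWith.of_le_mul_dist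
    intro x y
    rw [NNReal.coe_one, one_mul, Subtype.dist_eq, dist_eq_norm, dist_eq_norm]
    have e : g x - g y = ((x : ℂ) - y) + (s x • n x - s y • n y) := by simp only [g]; ring
    have h1 := hn x y (hKc.frontier_subset y.2)
    have h2 := hn y x (hKc.frontier_subset x.2)
    have h3 : ‖(x : ℂ) - y‖ ^ 2 ≤ ⟪g x - g y, (x : ℂ) - y⟫ := by
      rw [e, inner_add_left, real_inner_self_eq_norm_sq, inner_sub_left, real_inner_smul_left,
        real_inner_smul_left]
      have h1' : ⟪n x, (x : ℂ) - y⟫ = - ⟪n x, (y : ℂ) - x⟫ := by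
        rw [← inner_neg_right, neg_sub]
      rw [h1']
      nlinarith [mul_nonneg (hs x) (neg_nonneg.2 h1), mul_nonneg (hs y) (neg_nonneg.2 h2)]
    have h4 := real_inner_le_norm (g x - g y) ((x : ℂ) - y)
    rcases (norm_nonneg ((x : ℂ) - y)).eq_or_lt with h5 | h5
    · rw [← h5]; positivity
    · have h6 : ‖(x : ℂ) - y‖ * ‖(x : ℂ) - y‖ ≤ ‖g x - g y‖ * ‖(x : ℂ) - y‖ := by
        rw [← sq]; linarith
      exact le_of_mul_le_mul_right h6 h5
  unfold Pr
  have e1 : μH[1] (frontier K) = μH[1] (univ : Set (frontier K)) := by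
    have := (isometry_subtype_coe (s := frontier K)).hausdorffMeasure_image
      (d := 1) (Or.inl zero_le_one) univ
    rw [image_univ, Subtype.range_coe] at this
    exact this
  rw [e1]
  refine (hg.le_hausdorffMeasure_image zero_le_one univ).trans ?_
  simp only [ENNReal.coe_one, ENNReal.one_rpow, one_mul]
  apply measure_mono
  rintro _ ⟨x, -, rfl⟩
  exact hfr x

theorem det0 {n : ℂ →L[ℝ] ℝ} {w z x : ℂ} (hw : n w = 0) (hz : n z = 0) (hx : n x ≠ 0) :
    fv w z = 0 := by
  have e : ∀ y : ℂ, n y = y.re * n 1 + y.im * n Complex.I := fun y => by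
    have : y = y.re • (1 : ℂ) + y.im • Complex.I := by
      apply Complex.ext <;> simp
    conv_lhs => rw [this]
    rw [map_add, map_smul, map_smul]; rfl
  rw [e] at hw hz hx
  rw [fv_apply]
  by_contra h
  have h1 : n 1 = 0 := by
    have : n 1 * (w.re * z.im - w.im * z.re) = 0 := by linear_combination z.im * hw - w.im * hz
    exact (mul_eq_zero.1 this).resolve_right h
  have h2 : n Complex.I = 0 := by
    have : n Complex.I * (w.re * z.im - w.im * z.re) = 0 := by
      linear_combination w.re * hz - z.re * hw
    exact (mul_eq_zero.1 this).resolve_right h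
  simp [h1, h2] at hx

theorem par {z x : ℂ} (h : fv z x = 0) (hz : z ≠ 0) : ∃ s : ℝ, x = s • z := by
  rw [fv_apply] at h
  by_cases h1 : z.re = 0
  · have h2 : z.im ≠ 0 := fun h2 => hz (Complex.ext h1 h2)
    refine ⟨x.im / z.im, Complex.ext ?_ ?_⟩
    · simp [h1] at h ⊢; tauto
    · simp [h2]
  · refine ⟨x.re / z.re, Complex.ext ?_ ?_⟩
    · simp [h1]
    · simp; field_simp; linarith

theorem fv_self_smul (v : ℂ) (s : ℝ) : fv v (s • v) = 0 := by
  rw [fv_apply]; simp; ring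

/-- Polygon given by finitely many half planes. -/
def Qp (T : Finset (ℂ →L[ℝ] ℝ)) : Set ℂ := {x | ∀ n ∈ T, n x ≤ 1}

/-- Its faces. -/
def Fc (T : Finset (ℂ →L[ℝ] ℝ)) (n : ℂ →L[ℝ] ℝ) : Set ℂ := Qp T ∩ {x | n x = 1}

theorem Qp_closed (T : Finset (ℂ →L[ℝ] ℝ)) : IsClosed (Qp T) := by
  have : Qp T = ⋂ n ∈ T, {x | n x ≤ 1} := by ext x; simp [Qp]
  rw [this]
  exact isClosed_biInter fun n _ => isClosed_le n.continuous continuous_const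

theorem Qp_convex (T : Finset (ℂ →L[ℝ] ℝ)) : Convex ℝ (Qp T) := by
  intro x hx y hy a b ha hb hab n hn
  rw [map_add, map_smul, map_smul, smul_eq_mul, smul_eq_mul]
  nlinarith [hx n hn, hy n hn]

theorem Fc_convex (T : Finset (ℂ →L[ℝ] ℝ)) (n : ℂ →L[ℝ] ℝ) : Convex ℝ (Fc T n) := by
  refine (Qp_convex T).inter ?_
  intro x hx y hy a b ha hb hab
  have hx : n x = 1 := hx
  have hy : n y = 1 := hy
  change n _ = 1
  rw [map_add, map_smul, map_smul, hx, hy]; simpa using hab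

theorem Fc_compact (T : Finset (ℂ →L[ℝ] ℝ)) (hQ : IsCompact (Qp T)) (n : ℂ →L[ℝ] ℝ) :
    IsCompact (Fc T n) :=
  hQ.inter_right (isClosed_eq n.continuous continuous_const)

theorem frontier_Qp (T : Finset (ℂ →L[ℝ] ℝ)) : frontier (Qp T) = ⋃ n ∈ T, Fc T n := by
  rw [(Qp_closed T).frontier_eq]
  ext x
  simp only [Set.mem_sdiff, mem_iUnion, exists_prop]
  constructor
  · rintro ⟨h1, h2⟩
    by_contra! h3
    apply h2
    have : IsOpen (⋂ n ∈ T, {x : ℂ | n x < 1}) :=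
      isOpen_biInter_finset fun n _ => isOpen_lt n.continuous continuous_const
    refine mem_interior.2 ⟨_, ?_, this, ?_⟩
    · intro y hy n hn
      simp only [mem_iInter] at hy
      exact (hy n hn).le
    · simp only [mem_iInter]
      intro n hn
      exact lt_of_le_of_ne (h1 n hn) fun h => h3 n hn ⟨h1, h⟩
  · rintro ⟨n, hn, h1, h2⟩
    refine ⟨h1, fun h3 => ?_⟩
    have h2 : n x = 1 := h2
    have hc : Tendsto (fun s : ℝ => s • x) (nhds 1) (nhds x) := by
      have : Continuous (fun s : ℝ => s • x) := by fun_prop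
      simpa using this.tendsto 1
    have h4 := hc (mem_interior_iff_mem_nhds.1 h3)
    obtain ⟨δ, hδ, hb⟩ := Metric.mem_nhds_iff.1 h4
    have h5 : (1 + δ / 2) • x ∈ Qp T := by
      apply hb
      rw [Metric.mem_ball, Real.dist_eq, add_sub_cancel_left, abs_of_pos (by positivity)]
      linarith
    have h6 := h5 n hn
    rw [map_smul, h2, smul_eq_mul] at h6
    linarith

theorem Fc_inter (T : Finset (ℂ →L[ℝ] ℝ)) {n m : ℂ →L[ℝ] ℝ} (hnm : n ≠ m) :
    (Fc T n ∩ Fc T m).Subsingleton := by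
  rintro x ⟨⟨-, hx1⟩, ⟨-, hx2⟩⟩ y ⟨⟨-, hy1⟩, ⟨-, hy2⟩⟩
  have hx1 : n x = 1 := hx1
  have hx2 : m x = 1 := hx2
  have hy1 : n y = 1 := hy1
  have hy2 : m y = 1 := hy2
  by_contra hxy
  apply hnm
  ext w
  by_contra hw
  have h1 : (n - m) (x - y) = 0 := by simp [hx1, hx2, hy1, hy2]
  have h2 : (n - m) x = 0 := by simp [hx1, hx2]
  have h3 : (n - m) w ≠ 0 := by simpa using sub_ne_zero.2 hw
  obtain ⟨s, hs⟩ := par (det0 h1 h2 h3) (sub_ne_zero.2 hxy)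
  have : n x = 0 := by rw [hs, map_smul, map_sub, hx1, hy1]; simp
  rw [hx1] at this
  exact one_ne_zero this

theorem Fc_segment (T : Finset (ℂ →L[ℝ] ℝ)) (hQ : IsCompact (Qp T)) (n : ℂ →L[ℝ] ℝ)
    (hne : (Fc T n).Nonempty) : ∃ a b, Fc T n = segment ℝ a b := by
  obtain ⟨x₀, hx₀⟩ := id hne
  have hx1 : n x₀ = 1 := hx₀.2
  set d : ℂ := (n Complex.I) • (1 : ℂ) - (n 1) • Complex.I with hd
  have hnd : n d = 0 := by
    rw [hd, map_sub, map_smul, map_smul]; simp [mul_comm]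
  have hd0 : d ≠ 0 := by
    intro h
    have h1 := congrArg Complex.re h
    have h2 := congrArg Complex.im h
    simp [hd] at h1 h2
    have : x₀ = x₀.re • (1 : ℂ) + x₀.im • Complex.I := by apply Complex.ext <;> simp
    rw [this, map_add, map_smul, map_smul, h1, h2] at hx1
    simp at hx1
  have hpar : ∀ x ∈ Fc T n, ∃ s : ℝ, x = x₀ + s • d := by
    intro x hx
    have h1 : n (x - x₀) = 0 := by rw [map_sub, hx1, sub_eq_zero]; exact hx.2
    obtain ⟨s, hs⟩ := par (det0 hnd h1 (by rw [hx1]; exact one_ne_zero)) hd0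
    exact ⟨s, by rw [← hs]; ring⟩
  have hcF := Fc_compact T hQ n
  obtain ⟨a, ha, hamin⟩ := hcF.exists_isMinOn hne (f := fun x => ⟪d, x⟫) (by fun_prop)
  obtain ⟨b, hb, hbmax⟩ := hcF.exists_isMaxOn hne (f := fun x => ⟪d, x⟫) (by fun_prop)
  refine ⟨a, b, Subset.antisymm ?_ ((Fc_convex T n).segment_subset ha hb)⟩
  intro x hx
  have i1 : ⟪d, a⟫ ≤ ⟪d, x⟫ := hamin hx
  have i2 : ⟪d, x⟫ ≤ ⟪d, b⟫ := hbmax hx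
  obtain ⟨sa, rfl⟩ := hpar a ha
  obtain ⟨sb, rfl⟩ := hpar b hb
  obtain ⟨s, rfl⟩ := hpar x hx
  have hdd : 0 < ⟪d, d⟫ := by
    rw [real_inner_self_eq_norm_sq]; have := norm_pos_iff.2 hd0; positivity
  simp only [inner_add_right, real_inner_smul_right] at i1 i2
  have j1 : sa ≤ s := le_of_mul_le_mul_right (by linarith) hdd
  have j2 : s ≤ sb := le_of_mul_le_mul_right (by linarith) hdd
  have hseg := image_segment ℝ (AffineMap.lineMap x₀ (x₀ + d) : ℝ →ᵃ[ℝ] ℂ) sa sb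
  have hl : ∀ t : ℝ, (AffineMap.lineMap x₀ (x₀ + d) : ℝ →ᵃ[ℝ] ℂ) t = x₀ + t • d := fun t => by
    rw [AffineMap.lineMap_apply]; simp [add_comm]
  rw [hl, hl, segment_eq_Icc (j1.trans j2)] at hseg
  rw [← hseg]
  exact ⟨s, ⟨j1, j2⟩, hl s⟩


theorem Wd_neg (v : ℂ) (K : Set ℂ) : Wd (-v) K = Wd v K := by
  unfold Wd
  have : fv (-v) '' K = (-1 : ℝ) • (fv v '' K) := by
    rw [← image_smul, image_image]
    apply image_congr
    intro x _
    rw [fv_apply, fv_apply]; simp; ring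
  rw [this, measureReal_def, Measure.addHaar_smul]
  simp [measureReal_def]

theorem Wd_zero_of_subsingleton {v : ℂ} {K : Set ℂ} (h : (fv v '' K).Subsingleton) :
    Wd v K = 0 := by
  unfold Wd
  rw [measureReal_def, h.measure_zero]; rfl

theorem Wd_segment (v a b : ℂ) : Wd v (segment ℝ a b) = |fv v (b - a)| := by
  unfold Wd
  have := image_segment ℝ ((fv v).toLinearMap.toAffineMap) a b
  have h2 : fv v '' segment ℝ a b = segment ℝ (fv v a) (fv v b) := by simpa using this
  rw [h2, segment_eq_uIcc, measureReal_def, Real.volume_interval, map_sub,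
    ENNReal.toReal_ofReal (abs_nonneg _)]

theorem Wd_upper (T : Finset (ℂ →L[ℝ] ℝ)) (hQ : IsCompact (Qp T)) {v : ℂ} (hv : v ≠ 0) :
    Wd v (Qp T) = ∑ n ∈ T with 0 < n v, Wd v (Fc T n) := by
  unfold Wd
  have hU : fv v '' Qp T = ⋃ n ∈ T.filter (fun n => 0 < n v), fv v '' Fc T n := by
    apply Subset.antisymm
    · rintro _ ⟨x, hx, rfl⟩
      have hne : (T.filter (fun n => 0 < n v)).Nonempty := by
        by_contra! hemp
        have hray : ∀ s : ℝ, 0 ≤ s → x + s • v ∈ Qp T := by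
          intro s hs n hn
          have : n v ≤ 0 := by
            by_contra! h
            have : n ∈ T.filter (fun n => 0 < n v) := Finset.mem_filter.2 ⟨hn, h⟩
            rw [hemp] at this
            exact absurd this (Finset.notMem_empty n)
          rw [map_add, map_smul, smul_eq_mul]
          nlinarith [hx n hn]
        obtain ⟨R, hR⟩ := hQ.isBounded.subset_closedBall x
        have hn0 : 0 < ‖v‖ := norm_pos_iff.2 hv
        have h2 := hR (hray ((|R| + 1) / ‖v‖) (by positivity))
        rw [Metric.mem_closedBall, dist_eq_norm, add_sub_cancel_left, norm_smul, Real.norm_eq_abs,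
          abs_of_nonneg (by positivity), div_mul_cancel₀ _ hn0.ne'] at h2
        linarith [le_abs_self R]
      obtain ⟨m, hm, hmin⟩ := Finset.exists_min_image _ (fun n => (1 - n x) / n v) hne
      obtain ⟨hmT, hmv⟩ := Finset.mem_filter.1 hm
      have hs0 : 0 ≤ (1 - m x) / m v := div_nonneg (by linarith [hx m hmT]) hmv.le
      simp only [mem_iUnion, exists_prop]
      refine ⟨m, hm, x + ((1 - m x) / m v) • v, ⟨?_, ?_⟩, ?_⟩
      · intro n hn
        rw [map_add, map_smul, smul_eq_mul]
        by_cases h : 0 < n v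
        · have h3 := hmin n (Finset.mem_filter.2 ⟨hn, h⟩)
          have h4 := mul_le_mul_of_nonneg_right h3 h.le
          rw [div_mul_cancel₀ (1 - n x) h.ne'] at h4
          linarith
        · nlinarith [hx n hn]
      · change m _ = 1
        rw [map_add, map_smul, smul_eq_mul, div_mul_cancel₀ _ hmv.ne']; ring
      · rw [map_add, fv_self_smul, add_zero]
    · simp only [iUnion_subset_iff]
      intro n _
      exact image_mono inter_subset_left
  rw [hU]
  apply measureReal_biUnion_finset₀
  · intro i hi j hj hij
    obtain ⟨hiT, hiv⟩ := Finset.mem_filter.1 hi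
    obtain ⟨hjT, hjv⟩ := Finset.mem_filter.1 hj
    have hsub : fv v '' Fc T i ∩ fv v '' Fc T j ⊆ fv v '' (Fc T i ∩ Fc T j) := by
      rintro _ ⟨⟨x, hx, rfl⟩, ⟨y, hy, hxy⟩⟩
      have h0 : fv v (y - x) = 0 := by rw [map_sub, hxy, sub_self]
      obtain ⟨s, hs⟩ := par h0 hv
      have hy' : y = x + s • v := by rw [← hs]; ring
      have hx1 : i x = 1 := hx.2
      have hy1 : j y = 1 := hy.2
      have h1 := hy.1 i hiT
      have h2 := hx.1 j hjT
      rw [hy', map_add, map_smul, smul_eq_mul] at h1 hy1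
      have hs0 : s = 0 := by
        apply le_antisymm
        · by_contra! h; nlinarith
        · by_contra! h; nlinarith
      have : y = x := by rw [hy', hs0]; simp
      subst this
      exact ⟨y, ⟨hx, hy⟩, rfl⟩
    exact measure_mono_null hsub (((Fc_inter T hij).image _).measure_zero _)
  · intro n _
    exact ((Fc_compact T hQ n).image (fv v).continuous).measurableSet.nullMeasurableSet
  · intro n _
    exact ((Fc_compact T hQ n).image (fv v).continuous).measure_ne_top

theorem two_Wd (T : Finset (ℂ →L[ℝ] ℝ)) (hQ : IsCompact (Qp T)) {v : ℂ} (hv : v ≠ 0) :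
    2 * Wd v (Qp T) = ∑ n ∈ T, Wd v (Fc T n) := by
  have h1 := Wd_upper T hQ hv
  have h2 := Wd_upper T hQ (neg_ne_zero.2 hv)
  simp only [Wd_neg, map_neg, Left.neg_pos_iff] at h2
  rw [two_mul]
  nth_rewrite 1 [h1]
  rw [h2, Finset.sum_filter, Finset.sum_filter, ← Finset.sum_add_distrib]
  apply Finset.sum_congr rfl
  intro n _
  rcases lt_trichotomy (n v) 0 with h | h | h
  · simp [h, h.le, not_lt.2 h.le]
  · simp only [h, lt_irrefl, if_false, add_zero]
    symm
    apply Wd_zero_of_subsingleton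
    rintro _ ⟨x, hx, rfl⟩ _ ⟨y, hy, rfl⟩
    have hx1 : n x = 1 := hx.2
    have hy1 : n y = 1 := hy.2
    have h3 : n (x - y) = 0 := by rw [map_sub, hx1, hy1, sub_self]
    have := det0 h h3 (by rw [hx1]; exact one_ne_zero)
    rw [map_sub] at this
    linarith
  · simp [h, not_lt.2 h.le]

/-- The zonotope spanned by `v` is nearly a disc. -/
def Good (v : ℕ → ℂ) (N : ℕ) (ε : ℝ) : Prop :=
  (∀ k, v k ≠ 0) ∧ ∀ z : ℂ, (1 - ε) * (2 * ‖z‖) ≤ ∑ k ∈ Finset.range N, |fv (v k) z| ∧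
    ∑ k ∈ Finset.range N, |fv (v k) z| ≤ (1 + ε) * (2 * ‖z‖)

theorem face_comp {v : ℕ → ℂ} {N : ℕ} {ε : ℝ} (hg : Good v N ε)
    (T : Finset (ℂ →L[ℝ] ℝ)) (hQ : IsCompact (Qp T)) (n : ℂ →L[ℝ] ℝ) :
    μH[1] (Fc T n) ≠ ∞ ∧ (1 - ε) * (2 * (μH[1]).real (Fc T n)) ≤ pz v N (Fc T n) ∧
      pz v N (Fc T n) ≤ (1 + ε) * (2 * (μH[1]).real (Fc T n)) := by
  rcases (Fc T n).eq_empty_or_nonempty with h | h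
  · rw [h]; simp [pz, Wd]
  · obtain ⟨a, b, hab⟩ := Fc_segment T hQ n h
    rw [hab, measureReal_def, hausdorffMeasure_segment]
    refine ⟨edist_ne_top a b, ?_⟩
    have : (edist a b).toReal = ‖b - a‖ := by
      rw [edist_dist, ENNReal.toReal_ofReal dist_nonneg, dist_comm, dist_eq_norm]
    rw [this]
    have e : pz v N (segment ℝ a b) = ∑ k ∈ Finset.range N, |fv (v k) (b - a)| :=
      Finset.sum_congr rfl fun k _ => Wd_segment _ _ _
    rw [e]
    exact hg.2 (b - a)

theorem poly_comp {v : ℕ → ℂ} {N : ℕ} {ε : ℝ} (hg : Good v N ε)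
    (T : Finset (ℂ →L[ℝ] ℝ)) (hQ : IsCompact (Qp T)) :
    Pr (Qp T) ≠ ∞ ∧ (1 - ε) * (Pr (Qp T)).toReal ≤ pz v N (Qp T) ∧
      pz v N (Qp T) ≤ (1 + ε) * (Pr (Qp T)).toReal := by
  have hPr : Pr (Qp T) = ∑ n ∈ T, μH[1] (Fc T n) := by
    unfold Pr
    rw [frontier_Qp]
    apply measure_biUnion_finset₀
    · intro i _ j _ hij
      have := Measure.nullSingletonClass_hausdorff ℂ (zero_lt_one (α := ℝ))
      exact (Fc_inter T hij).measure_zero _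
    · intro n _
      exact (Fc_compact T hQ n).measurableSet.nullMeasurableSet
  have hfin : ∀ n ∈ T, μH[1] (Fc T n) ≠ ∞ := fun n _ => (face_comp hg T hQ n).1
  have hre : (Pr (Qp T)).toReal = ∑ n ∈ T, (μH[1]).real (Fc T n) := by
    rw [hPr, ENNReal.toReal_sum hfin]; rfl
  have h2 : 2 * pz v N (Qp T) = ∑ n ∈ T, pz v N (Fc T n) := by
    unfold pz
    rw [Finset.mul_sum, Finset.sum_comm]
    exact Finset.sum_congr rfl fun k _ => two_Wd T hQ (hg.1 k)
  have h3 : ∑ n ∈ T, (1 - ε) * (2 * (μH[1]).real (Fc T n)) ≤ ∑ n ∈ T, pz v N (Fc T n) :=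
    Finset.sum_le_sum fun n _ => (face_comp hg T hQ n).2.1
  have h4 : ∑ n ∈ T, pz v N (Fc T n) ≤ ∑ n ∈ T, (1 + ε) * (2 * (μH[1]).real (Fc T n)) :=
    Finset.sum_le_sum fun n _ => (face_comp hg T hQ n).2.2
  rw [← Finset.mul_sum, ← Finset.mul_sum, ← hre, ← h2] at h3 h4
  refine ⟨?_, by linarith, by linarith⟩
  rw [hPr]
  exact ENNReal.sum_ne_top.2 hfin

theorem exists_poly {K : Set ℂ} (hK : Bd K) (h0 : (0:ℂ) ∈ interior K) {c : ℝ} (hc : 1 < c) :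
    ∃ T, K ⊆ Qp T ∧ Qp T ⊆ c • K := by
  have hc0 : 0 < c := by linarith
  have hcpt : IsCompact (frontier (c • K)) := (hK.smul c).cpt.of_isClosed_subset isClosed_frontier
    (hK.smul c).cpt.isClosed.frontier_subset
  -- points of the frontier are outside `K`
  have hout : ∀ x ∈ frontier (c • K), x ∉ K := by
    intro x hx hxK
    apply hx.2
    have h1 : c⁻¹ • x ∈ interior K := by
      have := hK.cvx.openSegment_interior_self_subset_interior h0 hxK
      apply this
      refine ⟨1 - c⁻¹, c⁻¹, ?_, by positivity, by ring, by simp⟩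
      rw [sub_pos]; exact inv_lt_one_of_one_lt₀ hc
    rw [interior_smul₀ hc0.ne']
    exact ⟨_, h1, by simp only; rw [smul_smul, mul_inv_cancel₀ hc0.ne', one_smul]⟩
  have H : ∀ x : frontier (c • K), ∃ n : ℂ →L[ℝ] ℝ, (∀ y ∈ K, n y ≤ 1) ∧ 1 < n x := by
    rintro ⟨x, hx⟩
    obtain ⟨f, r, h1, h2⟩ := geometric_hahn_banach_closed_point hK.cvx hK.cpt.isClosed (hout x hx)
    have hr : 0 < r := by simpa using h1 0 (interior_subset h0)
    refine ⟨r⁻¹ • f, ?_, ?_⟩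
    · intro y hy
      have := h1 y hy
      simp only [ContinuousLinearMap.smul_apply, smul_eq_mul]
      rw [inv_mul_le_iff₀ hr]; linarith
    · simp only [ContinuousLinearMap.smul_apply, smul_eq_mul]
      rw [lt_inv_mul_iff₀ hr]; linarith
  choose n hn1 hn2 using H
  classical
  obtain ⟨t, ht⟩ := hcpt.elim_finite_subcover (fun x : frontier (c • K) => {y | 1 < n x y})
    (fun x => isOpen_lt continuous_const (n x).continuous)
    (fun x hx => mem_iUnion.2 ⟨⟨x, hx⟩, hn2 ⟨x, hx⟩⟩)
  refine ⟨t.image n, ?_, ?_⟩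
  · intro y hy m hm
    obtain ⟨x, -, rfl⟩ := Finset.mem_image.1 hm
    exact hn1 x y hy
  · intro y hy
    by_contra hyc
    -- the segment from `0` to `y` meets the frontier
    have hdisj : ∀ z ∈ frontier (c • K), z ∉ Qp (t.image n) := by
      intro z hz hzQ
      obtain ⟨x, hx⟩ := mem_iUnion.1 (ht hz)
      obtain ⟨hxt, hx2⟩ := mem_iUnion.1 hx
      have h5 : 1 < n x z := hx2
      exact absurd (hzQ (n x) (Finset.mem_image_of_mem n hxt)) (not_le.2 h5)
    have h0Q : (0:ℂ) ∈ Qp (t.image n) := fun m _ => by simp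
    have hpre : IsPreconnected (segment ℝ 0 y) := (convex_segment 0 y).isPreconnected
    have hfr : frontier (c • K) = c • K \ interior (c • K) :=
      (hK.smul c).cpt.isClosed.frontier_eq
    have := hpre (interior (c • K)) (c • K)ᶜ isOpen_interior
      (hK.smul c).cpt.isClosed.isOpen_compl ?_ ?_ ?_
    · obtain ⟨z, -, h1, h2⟩ := this
      exact h2 (interior_subset h1)
    · intro z hz
      have hzQ := (Qp_convex (t.image n)).segment_subset h0Q hy hz
      by_cases h : z ∈ c • K
      · left
        by_contra h'
        exact hdisj z (by rw [hfr]; exact ⟨h, h'⟩) hzQ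
      · right; exact h
    · refine ⟨0, left_mem_segment _ _ _, ?_⟩
      rw [interior_smul₀ hc0.ne']
      exact ⟨0, h0, by simp⟩
    · exact ⟨y, right_mem_segment _ _ _, hyc⟩

theorem body_comp {v : ℕ → ℂ} {N : ℕ} {ε : ℝ} (hg : Good v N ε) (hε0 : 0 < ε) (hε : ε < 1)
    {K : Set ℂ} (hK : Bd K) (h0 : (0:ℂ) ∈ interior K) :
    Pr K ≠ ∞ ∧ (1 - ε) * (Pr K).toReal ≤ pz v N K ∧
      pz v N K ≤ (1 + ε) * (Pr K).toReal := by
  have hfin : Pr K ≠ ∞ := by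
    obtain ⟨T, h1, h2⟩ := exists_poly hK h0 (c := 2) (by norm_num)
    have hQ : IsCompact (Qp T) := (hK.smul 2).cpt.of_isClosed_subset (Qp_closed T) h2
    exact ne_top_of_le_ne_top (poly_comp hg T hQ).1
      (Pr_mono hK.cvx hK.cpt.isClosed ⟨0, h0⟩ hQ h1)
  have key : ∀ c : ℝ, 1 < c → (1 - ε) * (Pr K).toReal ≤ c * pz v N K ∧
      pz v N K ≤ c * ((1 + ε) * (Pr K).toReal) := by
    intro c hc
    have hc0 : 0 < c := by linarith
    obtain ⟨T, h1, h2⟩ := exists_poly hK h0 hc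
    have hQ : IsCompact (Qp T) := (hK.smul c).cpt.of_isClosed_subset (Qp_closed T) h2
    obtain ⟨a1, a2, a3⟩ := poly_comp hg T hQ
    have b1 : (Pr K).toReal ≤ (Pr (Qp T)).toReal :=
      ENNReal.toReal_mono a1 (Pr_mono hK.cvx hK.cpt.isClosed ⟨0, h0⟩ hQ h1)
    have b2 : (Pr (Qp T)).toReal ≤ c * (Pr K).toReal := by
      have := Pr_mono (Qp_convex T) (Qp_closed T) ⟨0, interior_mono h1 h0⟩ (hK.smul c).cpt h2
      rw [Pr_smul K hc0] at this
      have := ENNReal.toReal_mono (ENNReal.mul_ne_top ENNReal.ofReal_ne_top hfin) this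
      rwa [ENNReal.toReal_mul, ENNReal.toReal_ofReal hc0.le] at this
    have b3 := pz_mono v N hQ h1
    have b4 := pz_mono v N (hK.smul c).cpt h2
    rw [pz_smul v N K hc0.le] at b4
    constructor
    · nlinarith
    · nlinarith
  have lim : ∀ x y : ℝ, (∀ c : ℝ, 1 < c → x ≤ c * y) → x ≤ y := by
    intro x y h
    have ht : Tendsto (fun c : ℝ => c * y) (nhdsWithin 1 (Ioi 1)) (nhds (1 * y)) :=
      ((continuous_id.mul continuous_const).tendsto 1).mono_left nhdsWithin_le_nhds
    rw [one_mul] at ht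
    exact ge_of_tendsto ht (eventually_nhdsWithin_of_forall fun c hc => h c hc)
  exact ⟨hfin, lim _ _ fun c hc => (key c hc).1, lim _ _ fun c hc => (key c hc).2⟩


theorem int_abs_sin (φ : ℝ) : ∫ θ in (0:ℝ)..Real.pi, |Real.sin (φ - θ)| = 2 := by
  rw [intervalIntegral.integral_comp_sub_left (fun x => |Real.sin x|) φ, sub_zero]
  have hp : Function.Periodic (fun x => |Real.sin x|) Real.pi := by
    intro x
    simp [Real.sin_add_pi]
  have h := hp.intervalIntegral_add_eq (φ - Real.pi) 0
  rw [sub_add_cancel, zero_add] at h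
  rw [h]
  have : ∫ x in (0:ℝ)..Real.pi, |Real.sin x| = ∫ x in (0:ℝ)..Real.pi, Real.sin x := by
    apply intervalIntegral.integral_congr
    intro x hx
    rw [uIcc_of_le Real.pi_pos.le] at hx
    exact abs_of_nonneg (Real.sin_nonneg_of_mem_Icc hx)
  rw [this, integral_sin]
  simp; norm_num

theorem riemann_sin (φ : ℝ) {N : ℕ} (hN : 0 < N) :
    |∑ k ∈ Finset.range N, (Real.pi / N) * |Real.sin (φ - Real.pi / N * k)| - 2|
      ≤ Real.pi ^ 2 / N := by
  have hN' : (0:ℝ) < N := by exact_mod_cast hN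
  set d : ℝ := Real.pi / N with hd
  have hd0 : 0 < d := div_pos Real.pi_pos hN'
  set f : ℝ → ℝ := fun θ => |Real.sin (φ - θ)| with hf
  have hfc : Continuous f := by fun_prop
  have hfint : ∀ a b, IntervalIntegrable f volume a b := fun a b => hfc.intervalIntegrable a b
  have hsum := intervalIntegral.sum_integral_adjacent_intervals (f := f) (μ := volume)
    (a := fun k : ℕ => d * k) (n := N) (fun k _ => hfint _ _)
  have hdN : d * N = Real.pi := by rw [hd]; field_simp
  simp only [Nat.cast_zero, mul_zero, hdN] at hsum
  rw [show ∫ x in (0:ℝ)..Real.pi, f x = 2 from int_abs_sin φ] at hsum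
  rw [← hsum, ← Finset.sum_sub_distrib]
  refine (Finset.abs_sum_le_sum_abs _ _).trans ?_
  have key : ∀ k ∈ Finset.range N, |d * f (d * k) - ∫ x in (d * (k:ℕ))..(d * ((k+1 : ℕ) : ℝ)), f x|
      ≤ d ^ 2 := by
    intro k _
    have e : d * f (d * k) = ∫ x in (d * (k:ℕ))..(d * ((k+1 : ℕ) : ℝ)), f (d * k) := by
      rw [intervalIntegral.integral_const, smul_eq_mul]; push_cast; ring
    rw [e, ← intervalIntegral.integral_sub intervalIntegrable_const (hfint _ _), ← Real.norm_eq_abs]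
    refine (intervalIntegral.norm_integral_le_of_norm_le_const (C := d) ?_).trans ?_
    · intro x hx
      rw [uIoc_of_le (by push_cast; nlinarith)] at hx
      rw [Real.norm_eq_abs]
      refine (abs_abs_sub_abs_le_abs_sub _ _).trans ?_
      have hl := Real.abs_sin_sub_sin_le (φ - d * k) (φ - x)
      refine hl.trans ?_
      rw [abs_le]
      have := hx.1
      have := hx.2
      push_cast at this
      constructor <;> linarith
    · push_cast
      rw [show d * ((k:ℝ) + 1) - d * k = d by ring, abs_of_pos hd0]
      exact le_of_eq (by ring)
  refine (Finset.sum_le_sum key).trans (le_of_eq ?_)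
  rw [Finset.sum_const, Finset.card_range, nsmul_eq_mul, hd]
  field_simp

theorem exists_good {ε : ℝ} (hε : 0 < ε) : ∃ v N, Good v N ε ∧ 0 < N := by
  obtain ⟨N, hN⟩ := exists_nat_gt (Real.pi ^ 2 / (2 * ε))
  have hN' : (0:ℝ) < N := lt_of_le_of_lt (by positivity) hN
  have hN0 : 0 < N := by exact_mod_cast hN'
  have hle : Real.pi ^ 2 / N ≤ 2 * ε := by
    rw [div_lt_iff₀ (by positivity)] at hN
    rw [div_le_iff₀ hN']; linarith
  have hd0 : 0 < Real.pi / N := div_pos Real.pi_pos hN'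
  refine ⟨fun k => ⟨Real.pi / N * Real.cos (Real.pi / N * k), Real.pi / N * Real.sin (Real.pi / N * k)⟩,
    N, ⟨?_, ?_⟩, hN0⟩
  · intro k h
    have h1 := congrArg Complex.re h
    have h2 := congrArg Complex.im h
    simp only [Complex.zero_re, Complex.zero_im, mul_eq_zero, hd0.ne', false_or] at h1 h2
    have := Real.sin_sq_add_cos_sq (Real.pi / N * k)
    rw [h1, h2] at this
    norm_num at this
  · intro z
    have h := riemann_sin (Complex.arg z) hN0
    have e : ∑ k ∈ Finset.range N, |fv ⟨Real.pi / N * Real.cos (Real.pi / N * k),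
        Real.pi / N * Real.sin (Real.pi / N * k)⟩ z| =
        ‖z‖ * ∑ k ∈ Finset.range N, (Real.pi / N) * |Real.sin (Complex.arg z - Real.pi / N * k)| := by
      rw [Finset.mul_sum]
      apply Finset.sum_congr rfl
      intro k _
      have hre : z.re = ‖z‖ * Real.cos (Complex.arg z) := (Complex.norm_mul_cos_arg z).symm
      have him : z.im = ‖z‖ * Real.sin (Complex.arg z) := (Complex.norm_mul_sin_arg z).symm
      rw [fv_apply]
      have : Real.pi / N * Real.cos (Real.pi / N * k) * z.im -
          Real.pi / N * Real.sin (Real.pi / N * k) * z.re =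
          ‖z‖ * ((Real.pi / N) * Real.sin (Complex.arg z - Real.pi / N * k)) := by
        rw [hre, him, Real.sin_sub]; ring
      simp only [this, abs_mul, abs_of_pos hd0, abs_of_nonneg (norm_nonneg z)]
    simp only [e]
    have h' := abs_le.1 (h.trans hle)
    have hz := norm_nonneg z
    constructor <;> nlinarith

open Topology in
theorem exists_seq : ∃ (v : ℕ → ℕ → ℂ) (N : ℕ → ℕ), ∀ K : Set ℂ, Bd K → (0:ℂ) ∈ interior K →
    Pr K ≠ ∞ ∧ 0 < (Pr K).toReal ∧ (∀ n, 0 < pz (v n) (N n) K) ∧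
      Tendsto (fun n => pz (v n) (N n) K) atTop (𝓝 (Pr K).toReal) := by
  have H : ∀ n : ℕ, ∃ v N, Good v N (1 / ((n:ℝ) + 2)) ∧ 0 < N := fun n =>
    exists_good (by positivity)
  choose v N hg hN using H
  have hε0 : ∀ n : ℕ, (0:ℝ) < 1 / ((n:ℝ) + 2) := fun n => by positivity
  have hε1 : ∀ n : ℕ, 1 / ((n:ℝ) + 2) < (1:ℝ) := fun n => by
    rw [div_lt_one (by positivity)]
    have : (0:ℝ) ≤ n := by positivity
    linarith
  refine ⟨v, N, fun K hK h0 => ?_⟩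
  have hc := fun n => body_comp (hg n) (hε0 n) (hε1 n) hK h0
  have hpos : ∀ w : ℂ, w ≠ 0 → 0 < Wd w K := by
    intro w hw
    have hcont : ContinuousAt (fun s : ℝ => s • (Complex.I * w)) 0 := by fun_prop
    have hnb : K ∈ 𝓝 ((0:ℝ) • (Complex.I * w)) := by
      rw [zero_smul]; exact mem_interior_iff_mem_nhds.1 h0
    have hev : ∀ᶠ s : ℝ in 𝓝 0, s • (Complex.I * w) ∈ K := hcont hnb
    obtain ⟨r, hr, hb⟩ := Metric.eventually_nhds_iff.1 hev
    have hin : (r / 2) • (Complex.I * w) ∈ K := by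
      apply hb
      rw [Real.dist_eq, sub_zero, abs_of_pos (by positivity)]
      linarith
    have hs := hK.cvx.segment_subset (interior_subset h0) hin
    refine lt_of_lt_of_le ?_ (Wd_mono w hK.cpt hs)
    rw [Wd_segment, sub_zero, fv_apply]
    apply abs_pos.2
    have hn : 0 < w.re * w.re + w.im * w.im := by
      have := Complex.normSq_pos.2 hw
      rwa [Complex.normSq_apply] at this
    simp
    have : w.re * (r / 2 * w.re) + w.im * (r / 2 * w.im) =
      r / 2 * (w.re * w.re + w.im * w.im) := by ring
    rw [this]
    positivity
  have hp : ∀ n, 0 < pz (v n) (N n) K := fun n => by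
    unfold pz
    apply Finset.sum_pos
    · intro k _; exact hpos _ ((hg n).1 k)
    · exact Finset.nonempty_range_iff.2 (hN n).ne'
  refine ⟨(hc 0).1, ?_, hp, ?_⟩
  · have h1 := (hp 0).trans_le (hc 0).2.2
    exact pos_of_mul_pos_right h1 (by have := hε0 0; linarith)
  · have hlim : Tendsto (fun n : ℕ => 1 / ((n:ℝ) + 2)) atTop (𝓝 0) := by
      simp only [one_div]
      exact tendsto_inv_atTop_zero.comp
        (tendsto_atTop_add_const_right _ _ tendsto_natCast_atTop_atTop)
    have l1 : Tendsto (fun n : ℕ => (1 - 1 / ((n:ℝ) + 2)) * (Pr K).toReal) atTop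
        (𝓝 (Pr K).toReal) := by
      simpa using (hlim.const_sub 1).mul_const (Pr K).toReal
    have l2 : Tendsto (fun n : ℕ => (1 + 1 / ((n:ℝ) + 2)) * (Pr K).toReal) atTop
        (𝓝 (Pr K).toReal) := by
      simpa using (hlim.const_add 1).mul_const (Pr K).toReal
    exact tendsto_of_tendsto_of_tendsto_of_le_of_le l1 l2 (fun n => (hc n).2.1)
      (fun n => (hc n).2.2)

theorem sub_comb {E : Type*} [AddCommGroup E] [Module ℝ E] {C B : Set E} (h : B ⊆ C) (t : ℝ) :
    B ⊆ (1 - t) • C + t • B := fun x hx =>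
  ⟨(1 - t) • x, smul_mem_smul_set (h hx), t • x, smul_mem_smul_set hx, by
    simp only [← add_smul]; simp⟩

theorem planar {C B : Set ℂ} (hC : Bd C) (hB : Bd B) (hBC : B ⊆ C) (h0 : (0:ℂ) ∈ interior B)
    {t : ℝ} (ht : t ∈ Icc (0:ℝ) 1) :
    Pr ((1 - t) • C + t • B) ≠ ∞ ∧
    (Pr ((1 - t) • C + t • B)).toReal = (1 - t) * (Pr C).toReal + t * (Pr B).toReal ∧
    (Pr ((1 - t) • C + t • B)).toReal *
      ((1 - t) * (Ar C / (Pr C).toReal) + t * (Ar B / (Pr B).toReal)) ≤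
        Ar ((1 - t) • C + t • B) := by
  obtain ⟨v, N, H⟩ := exists_seq
  have hCt : Bd ((1 - t) • C + t • B) := (hC.smul _).add (hB.smul _)
  obtain ⟨f0, q0, p0, l0⟩ := H C hC (interior_mono hBC h0)
  obtain ⟨f1, q1, p1, l1⟩ := H B hB h0
  obtain ⟨ft, qt, pt, lt⟩ := H _ hCt (interior_mono (sub_comb hBC t) h0)
  have ht1 : 0 ≤ 1 - t := by linarith [ht.2]
  have e : ∀ n, pz (v n) (N n) ((1 - t) • C + t • B) =
      (1 - t) * pz (v n) (N n) C + t * pz (v n) (N n) B := fun n => by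
    rw [pz_add _ _ (hC.smul _) (hB.smul _), pz_smul _ _ _ ht1, pz_smul _ _ _ ht.1]
  refine ⟨ft, tendsto_nhds_unique lt ?_, ?_⟩
  · simp only [e]
    exact (l0.const_mul _).add (l1.const_mul _)
  · have hlim := lt.mul ((((tendsto_const_nhds (x := Ar C)).div l0 q0.ne').const_mul (1 - t)).add
      (((tendsto_const_nhds (x := Ar B)).div l1 q1.ne').const_mul t))
    refine le_of_tendsto hlim (Eventually.of_forall fun n => ?_)
    simp only [Pi.div_apply]
    rcases eq_or_lt_of_le ht.1 with h | h
    · subst h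
      have : (1 - (0:ℝ)) • C + (0:ℝ) • B = C := by
        rw [zero_smul_set hB.ne, add_zero]; simp
      rw [this]
      have := (p0 n).ne'
      apply le_of_eq; field_simp; ring
    rcases eq_or_lt_of_le ht.2 with h' | h'
    · subst h'
      have : (1 - (1:ℝ)) • C + (1:ℝ) • B = B := by
        rw [sub_self, zero_smul_set hC.ne, zero_add]; simp
      rw [this]
      have := (p1 n).ne'
      apply le_of_eq; field_simp; ring
    have h1t : 0 < 1 - t := by linarith
    have hm := main_Z (v n) (N n) (hC.smul (1 - t)) (hB.smul t)
      (by rw [interior_smul₀ h1t.ne']; exact ⟨0, 0, interior_mono hBC h0, by simp⟩)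
      (by rw [interior_smul₀ h.ne']; exact ⟨0, 0, h0, by simp⟩)
      (by rw [pz_smul _ _ _ ht1]; exact mul_pos h1t (p0 n))
      (by rw [pz_smul _ _ _ ht.1]; exact mul_pos h (p1 n))
    rw [pz_smul _ _ _ ht1, pz_smul _ _ _ ht.1, Ar_smul, Ar_smul] at hm
    rw [e]
    have := (p0 n).ne'
    have := (p1 n).ne'
    have a1 : (1 - t) ^ 2 * Ar C / ((1 - t) * pz (v n) (N n) C) =
      (1 - t) * (Ar C / pz (v n) (N n) C) := by field_simp
    have a2 : t ^ 2 * Ar B / (t * pz (v n) (N n) B) =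
      t * (Ar B / pz (v n) (N n) B) := by field_simp
    rwa [a1, a2] at hm

theorem Pr_pos {K : Set ℂ} (hK : Bd K) (h0 : (0:ℂ) ∈ interior K) :
    Pr K ≠ ∞ ∧ 0 < (Pr K).toReal := by
  obtain ⟨v, N, H⟩ := exists_seq
  exact ⟨(H K hK h0).1, (H K hK h0).2.1⟩

theorem lint_affine {a b : ℝ} (h : ∀ t ∈ Icc (0:ℝ) 1, 0 ≤ a + b * t) :
    ∫⁻ t in Icc (0:ℝ) 1, ENNReal.ofReal (a + b * t) = ENNReal.ofReal (a + b / 2) := by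
  rw [← ofReal_integral_eq_lintegral_ofReal]
  · rw [integral_Icc_eq_integral_Ioc, ← intervalIntegral.integral_of_le zero_le_one]
    congr 1
    rw [intervalIntegral.integral_add (by simp) (by
      exact (Continuous.intervalIntegrable (by fun_prop) _ _))]
    rw [intervalIntegral.integral_const_mul]
    simp; ring
  · exact (Continuous.integrableOn_Icc (by fun_prop))
  · exact (ae_restrict_iff' measurableSet_Icc).2 (Eventually.of_forall h)

theorem haar_two : ∃ c : ℝ, 0 < c ∧ ∀ S : Set ℂ, IsCompact S →
    μH[(2:ℝ)] S = ENNReal.ofReal (c * Ar S) := by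
  have h1 : Measure.IsAddHaarMeasure (μH[(2:ℝ)] : Measure ℂ) := by
    have := isAddHaarMeasure_hausdorffMeasure (E := ℂ)
    rwa [Complex.finrank_real_complex, Nat.cast_ofNat] at this
  have h2 := Measure.isAddLeftInvariant_eq_smul (μH[(2:ℝ)] : Measure ℂ) volume
  set c := Measure.addHaarScalarFactor (μH[(2:ℝ)] : Measure ℂ) volume with hc
  refine ⟨c, ?_, fun S hS => ?_⟩
  · exact_mod_cast Measure.addHaarScalarFactor_pos_of_isAddHaarMeasure _ _
  · rw [h2, Measure.smul_apply, ENNReal.ofReal_mul c.coe_nonneg]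
    unfold Ar
    rw [measureReal_def, ENNReal.ofReal_toReal hS.measure_ne_top]
    rw [ENNReal.smul_def, smul_eq_mul]; simp

theorem planar_final {C B : Set ℂ} (hC : Bd C) (hB : Bd B) (hBC : B ⊆ C)
    (h0 : (0:ℂ) ∈ interior B) (hlt : μH[(2:ℝ)] C / Pr C < μH[(2:ℝ)] B / Pr B) :
    μH[(2:ℝ)] C / Pr C < (∫⁻ t in Icc (0:ℝ) 1, μH[(2:ℝ)] ((1 - t) • C + t • B)) /
      ∫⁻ t in Icc (0:ℝ) 1, Pr ((1 - t) • C + t • B) := by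
  obtain ⟨c, hc, hμ⟩ := haar_two
  obtain ⟨f0, q0⟩ := Pr_pos hC (interior_mono hBC h0)
  obtain ⟨f1, q1⟩ := Pr_pos hB h0
  set x := (Pr C).toReal with hx
  set y := (Pr B).toReal with hy
  have eC : Pr C = ENNReal.ofReal x := (ENNReal.ofReal_toReal f0).symm
  have eB : Pr B = ENNReal.ofReal y := (ENNReal.ofReal_toReal f1).symm
  rw [hμ C hC.cpt, hμ B hB.cpt, eC, eB, ← ENNReal.ofReal_div_of_pos q0,
    ← ENNReal.ofReal_div_of_pos q1] at hlt
  rw [hμ C hC.cpt, eC, ← ENNReal.ofReal_div_of_pos q0]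
  set r := c * Ar C / x with hr
  set s := c * Ar B / y with hs
  have hr0 : 0 ≤ r := div_nonneg (mul_nonneg hc.le (Ar_nonneg _)) q0.le
  have hrs : r < s := (ENNReal.ofReal_lt_ofReal_iff_of_nonneg hr0).1 hlt
  set m := min x y with hm
  have hm0 : 0 < m := lt_min q0 q1
  have hP : ∫⁻ t in Icc (0:ℝ) 1, Pr ((1 - t) • C + t • B) = ENNReal.ofReal ((x + y) / 2) := by
    rw [show (x + y) / 2 = x + (y - x) / 2 by ring, ← lint_affine]
    · apply setLIntegral_congr_fun measurableSet_Icc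
      intro t ht
      obtain ⟨h1, h2, -⟩ := planar hC hB hBC h0 ht
      simp only
      rw [← ENNReal.ofReal_toReal h1, h2]
      congr 1; ring
    · intro t ht
      nlinarith [ht.1, ht.2]
  have hA : ENNReal.ofReal (r * (x + y) / 2 + (s - r) * m / 2) ≤
      ∫⁻ t in Icc (0:ℝ) 1, μH[(2:ℝ)] ((1 - t) • C + t • B) := by
    have e : r * (x + y) / 2 + (s - r) * m / 2 = r * x + (r * (y - x) + (s - r) * m) / 2 := by ring
    have hsr : 0 < s - r := sub_pos.2 hrs
    rw [e, ← lint_affine]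
    · apply setLIntegral_mono' measurableSet_Icc
      intro t ht
      obtain ⟨h1, h2, h3⟩ := planar hC hB hBC h0 ht
      rw [hμ _ ((hC.smul _).add (hB.smul _)).cpt]
      apply ENNReal.ofReal_le_ofReal
      have ht1 : 0 ≤ 1 - t := by linarith [ht.2]
      have h4 := mul_le_mul_of_nonneg_left h3 hc.le
      rw [h2] at h4
      refine le_trans ?_ h4
      have e2 : c * (((1 - t) * x + t * y) * ((1 - t) * (Ar C / x) + t * (Ar B / y))) =
          ((1 - t) * x + t * y) * ((1 - t) * r + t * s) := by rw [hr, hs]; ring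
      rw [← hx, ← hy, e2]
      have hq : m ≤ (1 - t) * x + t * y := by
        have a1 : m ≤ x := min_le_left _ _
        have a2 : m ≤ y := min_le_right _ _
        nlinarith [ht.1]
      have h5 : t * (s - r) * m ≤ t * (s - r) * ((1 - t) * x + t * y) :=
        mul_le_mul_of_nonneg_left hq (mul_nonneg ht.1 hsr.le)
      nlinarith
    · intro t ht
      have ht1 : 0 ≤ 1 - t := by linarith [ht.2]
      have : r * x + (r * (y - x) + (s - r) * m) * t =
        r * ((1 - t) * x + t * y) + (s - r) * m * t := by ring
      rw [this]
      have := ht.1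
      positivity
  rw [hP]
  have hxy : 0 < (x + y) / 2 := by positivity
  refine lt_of_lt_of_le ?_ (ENNReal.div_le_div_right hA _)
  rw [← ENNReal.ofReal_div_of_pos hxy]
  apply (ENNReal.ofReal_lt_ofReal_iff_of_nonneg hr0).2
  rw [lt_div_iff₀ hxy]
  have : 0 < (s - r) * m := mul_pos (sub_pos.2 hrs) hm0
  linarith

theorem intr_top {S : Set ℂ} (h : affineSpan ℝ S = ⊤) :
    intrinsicInterior ℝ S = interior S ∧ intrinsicFrontier ℝ S = frontier S := by
  have hopen : IsOpenMap ((↑) : affineSpan ℝ S → ℂ) := by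
    apply IsOpen.isOpenMap_subtype_val
    rw [h]; exact isOpen_univ
  have hsurj : Function.Surjective ((↑) : affineSpan ℝ S → ℂ) := fun x =>
    ⟨⟨x, by rw [h]; trivial⟩, rfl⟩
  unfold intrinsicInterior intrinsicFrontier
  rw [← hopen.preimage_interior_eq_interior_preimage continuous_subtype_val,
    ← hopen.preimage_frontier_eq_frontier_preimage continuous_subtype_val,
    image_preimage_eq _ hsurj, image_preimage_eq _ hsurj]
  exact ⟨rfl, rfl⟩

theorem proj_part (u : EuclideanSpace ℝ (Fin 3)) (hu : ‖u‖ = 1)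
    (C B : Set (EuclideanSpace ℝ (Fin 3))) (hCconv : Convex ℝ C)
    (hCperp : ∀ x ∈ C, ⟪x, u⟫ = 0) (hBC : B ⊆ C) :
    projPerp u (convexHull ℝ (C ∪ ((fun x => x + u) '' B))) = C := by
  unfold projPerp
  have hl : IsLinearMap ℝ (fun x : EuclideanSpace ℝ (Fin 3) => x - ⟪x, u⟫ • u) := by
    constructor
    · intro x y; rw [inner_add_left]; module
    · intro c x; rw [real_inner_smul_left]; module
  rw [hl.image_convexHull, image_union, image_image]
  have h1 : (fun x : EuclideanSpace ℝ (Fin 3) => x - ⟪x, u⟫ • u) '' C = C := by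
    rw [image_congr (g := id), image_id]
    intro x hx
    simp [hCperp x hx]
  have h2 : (fun x : EuclideanSpace ℝ (Fin 3) => (x + u) - ⟪x + u, u⟫ • u) '' B = B := by
    rw [image_congr (g := id), image_id]
    intro x hx
    simp [inner_add_left, hCperp x (hBC hx), real_inner_self_eq_norm_sq, hu]
  rw [h1, h2, union_eq_self_of_subset_right hBC, hCconv.convexHull_eq]

theorem ratio_part {E : Type*} [NormedAddCommGroup E] [InnerProductSpace ℝ E]
    [FiniteDimensional ℝ E] [MeasurableSpace E] [BorelSpace E]
    (C B : Set E)
    (hCc : IsCompact C) (hCconv : Convex ℝ C)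
    (hCdim : Module.finrank ℝ (affineSpan ℝ C).direction = 2)
    (hBC : B ⊆ C) (hBc : IsCompact B) (hBconv : Convex ℝ B)
    (hBdim : Module.finrank ℝ (affineSpan ℝ B).direction = 2)
    (hnotCheeger : μH[(2 : ℝ)] C / μH[(1 : ℝ)] (intrinsicFrontier ℝ C) <
      μH[(2 : ℝ)] B / μH[(1 : ℝ)] (intrinsicFrontier ℝ B)) :
    μH[(2 : ℝ)] C / μH[(1 : ℝ)] (intrinsicFrontier ℝ C) <
      (∫⁻ h in Set.Icc (0 : ℝ) 1, μH[(2 : ℝ)] ((1 - h) • C + h • B)) /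
        (∫⁻ h in Set.Icc (0 : ℝ) 1,
          μH[(1 : ℝ)] (intrinsicFrontier ℝ ((1 - h) • C + h • B))) := by
  have hBne : B.Nonempty := by
    by_contra! h
    rw [h, AffineSubspace.span_empty, AffineSubspace.direction_bot, finrank_bot] at hBdim
    exact absurd hBdim (by norm_num)
  obtain ⟨x₀, hx₀⟩ := hBne.intrinsicInterior hBconv
  have hx₀B : x₀ ∈ B := intrinsicInterior_subset hx₀
  set W := (affineSpan ℝ C).direction with hW
  have hr : Module.finrank ℝ ℂ = Module.finrank ℝ W := by
    rw [Complex.finrank_real_complex, hCdim]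
  let e : ℂ ≃ₗᵢ[ℝ] W := 
    (stdOrthonormalBasis ℝ ℂ).equiv (stdOrthonormalBasis ℝ W) (finCongr hr)
  let ψ : ℂ →ₗᵢ[ℝ] E := W.subtypeₗᵢ.comp e.toLinearIsometry
  let φ : ℂ →ᵃⁱ[ℝ] E := (AffineIsometryEquiv.vaddConst ℝ x₀).toAffineIsometry.comp ψ.toAffineIsometry
  have hφ : ∀ z, φ z = ψ z + x₀ := fun z => rfl
  have hφi : Isometry φ := φ.isometry
  have hrange : ∀ x ∈ C, ∃ z, φ z = x := by
    intro x hx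
    have : x - x₀ ∈ W := AffineSubspace.vsub_mem_direction (subset_affineSpan ℝ C hx)
      (subset_affineSpan ℝ C (hBC hx₀B))
    refine ⟨e.symm ⟨x - x₀, this⟩, ?_⟩
    rw [hφ]
    simp [ψ]
  have hsub : ∀ S ⊆ C, φ '' (φ ⁻¹' S) = S := fun S hS =>
    image_preimage_eq_of_subset fun x hx => hrange x (hS hx)
  have hbd : ∀ S ⊆ C, S.Nonempty → IsCompact S → Convex ℝ S → Bd (φ ⁻¹' S) := by
    intro S hS hne hc hcv
    refine ⟨hφi.isClosedEmbedding.isCompact_preimage hc, hcv.affine_preimage φ.toAffineMap, ?_⟩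
    obtain ⟨x, hx⟩ := hne
    obtain ⟨z, hz⟩ := hrange x (hS hx)
    exact ⟨z, by rw [mem_preimage, hz]; exact hx⟩
  have hB' := hbd B hBC hBne hBc hBconv
  have hC' := hbd C Subset.rfl (hBne.mono hBC) hCc hCconv
  have eB := hsub B hBC
  have eC := hsub C Subset.rfl
  set B' := φ ⁻¹' B with hBdef
  set C' := φ ⁻¹' C with hCdef
  have hBC' : B' ⊆ C' := preimage_mono hBC
  have htop : affineSpan ℝ B' = ⊤ := by
    have h1 : (affineSpan ℝ B').map φ.toAffineMap = affineSpan ℝ B := by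
      rw [AffineSubspace.map_span]
      congr 1
    have h2 := congrArg AffineSubspace.direction h1
    rw [AffineSubspace.map_direction] at h2
    have hinj : Function.Injective φ.toAffineMap.linear := ψ.injective
    have h3 := (Submodule.equivMapOfInjective _ hinj (affineSpan ℝ B').direction).finrank_eq
    rw [h2, hBdim] at h3
    have h4 : (affineSpan ℝ B').direction = ⊤ :=
      Submodule.eq_top_of_finrank_eq (by rw [h3, Complex.finrank_real_complex])
    exact (AffineSubspace.direction_eq_top_iff_of_nonempty
      ((affineSpan_nonempty ℝ).2 hB'.ne)).1 h4
  have hfr : ∀ S, B' ⊆ S → μH[(1:ℝ)] (intrinsicFrontier ℝ (φ '' S)) = Pr S := by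
    intro S hS
    rw [φ.intrinsicFrontier_image, hφi.hausdorffMeasure_image (Or.inl zero_le_one),
      (intr_top (top_unique (htop ▸ affineSpan_mono ℝ hS))).2]
    rfl
  have h2 : ∀ S, μH[(2:ℝ)] (φ '' S) = μH[(2:ℝ)] S := fun S =>
    hφi.hausdorffMeasure_image (Or.inl zero_le_two) S
  have h0 : (0:ℂ) ∈ interior B' := by
    rw [← eB, φ.intrinsicInterior_image, (intr_top htop).1] at hx₀
    obtain ⟨z, hz, hzx⟩ := hx₀
    have : φ z = φ 0 := by rw [hzx, hφ]; simp
    rwa [← φ.injective this]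
  have hcomb : ∀ t : ℝ, (1 - t) • C + t • B = φ '' ((1 - t) • C' + t • B') := by
    intro t
    have hf : ∀ a b : ℂ, φ ((1 - t) • a + t • b) = (1 - t) • φ a + t • φ b := by
      intro a b
      simp only [hφ, map_add, map_smul]
      module
    conv_lhs => rw [← eB, ← eC]
    ext x
    constructor
    · rintro ⟨_, ⟨_, ⟨a, ha, rfl⟩, rfl⟩, _, ⟨_, ⟨b, hb, rfl⟩, rfl⟩, rfl⟩
      exact ⟨_, ⟨_, ⟨a, ha, rfl⟩, _, ⟨b, hb, rfl⟩, rfl⟩, hf a b⟩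
    · rintro ⟨_, ⟨_, ⟨a, ha, rfl⟩, _, ⟨b, hb, rfl⟩, rfl⟩, rfl⟩
      exact ⟨_, ⟨_, ⟨a, ha, rfl⟩, rfl⟩, _, ⟨_, ⟨b, hb, rfl⟩, rfl⟩, (hf a b).symm⟩
  have hmain := planar_final hC' hB' hBC' h0
  simp only [hcomb]
  simp only [hfr _ (sub_comb hBC' _), h2]
  rw [← eC, ← eB, h2, h2, hfr _ Subset.rfl, hfr _ hBC'] at hnotCheeger
  rw [← eC, h2, hfr _ hBC']
  exact hmain hnotCheeger

theorem stmt15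
    (u : EuclideanSpace ℝ (Fin 3)) (hu : ‖u‖ = 1)
    (C B : Set (EuclideanSpace ℝ (Fin 3)))
    (hCc : IsCompact C) (hCconv : Convex ℝ C)
    (hCperp : ∀ x ∈ C, ⟪x, u⟫ = 0)
    (hCdim : Module.finrank ℝ (affineSpan ℝ C).direction = 2)
    (hBC : B ⊆ C) (hBc : IsCompact B) (hBconv : Convex ℝ B)
    (hBdim : Module.finrank ℝ (affineSpan ℝ B).direction = 2)
    (hnotCheeger : μH[(2 : ℝ)] C / μH[(1 : ℝ)] (intrinsicFrontier ℝ C) <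
      μH[(2 : ℝ)] B / μH[(1 : ℝ)] (intrinsicFrontier ℝ B))
    (K : Set (EuclideanSpace ℝ (Fin 3)))
    (hK : K = convexHull ℝ (C ∪ ((fun x => x + u) '' B))) :
    projPerp u K = C ∧
    μH[(2 : ℝ)] C / μH[(1 : ℝ)] (intrinsicFrontier ℝ C) <
      (∫⁻ h in Set.Icc (0 : ℝ) 1, μH[(2 : ℝ)] ((1 - h) • C + h • B)) /
        (∫⁻ h in Set.Icc (0 : ℝ) 1,
          μH[(1 : ℝ)] (intrinsicFrontier ℝ ((1 - h) • C + h • B))) := by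
  subst hK
  exact ⟨proj_part u hu C B hCconv hCperp hBC,
    ratio_part C B hCc hCconv hCdim hBC hBc hBconv hBdim hnotCheeger⟩
end
end

section
/- For planar convex bodies K and L (2-dimensional compact convex sets in R²), the inradius-type ratio satisfies H²(K+L)/H¹(∂(K+L)) ≥ H²(K)/H¹(∂K) + H²(L)/H¹(∂L), where K+L is the Minkowski sum. -/
open MeasureTheory Set Pointwise Filter
open scoped ENNReal RealInnerProductSpace

noncomputable section

/-! ### Discrete Wirtinger inequality -/

lemma parseval_shift (n : ℕ) [NeZero n] (f : ZMod n → ℝ) (m : ZMod n) :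
    ∑ k : ZMod n, ((∑ j, ZMod.stdAddChar (j * k) * (f j : ℂ)) *
      (∑ j, ZMod.stdAddChar (-(j * k)) * (f j : ℂ))) * ZMod.stdAddChar (m * k)
      = (n : ℂ) * ∑ i, (f i : ℂ) * f (i + m) := by
  have h1 : ∀ k : ZMod n, ((∑ j, ZMod.stdAddChar (j * k) * (f j : ℂ)) *
      (∑ j, ZMod.stdAddChar (-(j * k)) * (f j : ℂ))) * ZMod.stdAddChar (m * k)
      = ∑ i, ∑ j, (f i : ℂ) * f j * ZMod.stdAddChar (k * (i - j + m)) := by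
    intro k
    rw [Finset.sum_mul_sum, Finset.sum_mul]
    refine Finset.sum_congr rfl fun i _ => ?_
    rw [Finset.sum_mul]
    refine Finset.sum_congr rfl fun j _ => ?_
    have : k * (i - j + m) = i * k + (-(j * k)) + m * k := by ring
    rw [this, AddChar.map_add_eq_mul, AddChar.map_add_eq_mul]
    ring
  simp_rw [h1]
  rw [Finset.sum_comm, Finset.mul_sum]
  refine Finset.sum_congr rfl fun i _ => ?_
  rw [Finset.sum_comm]
  simp_rw [← Finset.mul_sum, AddChar.sum_mulShift _ (ZMod.isPrimitive_stdAddChar n)]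
  rw [Finset.sum_eq_single (i + m)]
  · simp; ring
  · intro b _ hb
    have : i - b + m ≠ 0 := by
      intro h; apply hb; linear_combination -h
    simp [this]
  · simp

lemma normSq_dft (n : ℕ) [NeZero n] (f : ZMod n → ℝ) (k : ZMod n) :
    (∑ j, ZMod.stdAddChar (j * k) * (f j : ℂ)) *
      (∑ j, ZMod.stdAddChar (-(j * k)) * (f j : ℂ)) =
      ((Complex.normSq (∑ j, ZMod.stdAddChar (j * k) * (f j : ℂ)) : ℝ) : ℂ) := by
  rw [← Complex.mul_conj]
  congr 1
  rw [map_sum]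
  refine Finset.sum_congr rfl fun i _ => ?_
  rw [map_mul, AddChar.map_neg_eq_conj, Complex.conj_ofReal]

lemma cos_le_aux (n : ℕ) (v : ℕ) (h1 : 1 ≤ v) (h2 : v < n) :
    Real.cos (2 * Real.pi * v / n) ≤ Real.cos (2 * Real.pi / n) := by
  have hn : (0:ℝ) < n := by exact_mod_cast (by omega : 0 < n)
  have hpi := Real.pi_pos
  have hv1 : (1:ℝ) ≤ v := by exact_mod_cast h1
  have hv2 : (v:ℝ) + 1 ≤ n := by exact_mod_cast h2
  by_cases h : 2 * v ≤ n
  · have h' : 2 * (v:ℝ) ≤ n := by exact_mod_cast h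
    apply Real.cos_le_cos_of_nonneg_of_le_pi
    · positivity
    · rw [div_le_iff₀ hn]; nlinarith
    · apply div_le_div_of_nonneg_right _ hn.le; nlinarith
  · have h' : (n:ℝ) ≤ 2 * v := by exact_mod_cast (by omega : n ≤ 2 * v)
    rw [← Real.cos_two_pi_sub (2 * Real.pi * v / n)]
    have e : 2 * Real.pi - 2 * Real.pi * v / n = 2 * Real.pi * (n - v) / n := by
      field_simp
    rw [e]
    apply Real.cos_le_cos_of_nonneg_of_le_pi
    · positivity
    · rw [div_le_iff₀ hn]; nlinarith
    · apply div_le_div_of_nonneg_right _ hn.le; nlinarith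

lemma wirtinger (n : ℕ) [NeZero n] (f : ZMod n → ℝ) (hf : ∑ j, f j = 0) :
    ∑ j, f j * f (j + 1) ≤ Real.cos (2 * Real.pi / n) * ∑ j, f j * f j := by
  have hn : (0:ℝ) < n := by exact_mod_cast Nat.pos_of_ne_zero (NeZero.ne n)
  set N : ZMod n → ℝ := fun k => Complex.normSq (∑ j, ZMod.stdAddChar (j * k) * (f j : ℂ)) with hN
  have key : ∀ m : ZMod n, ∑ k, N k * (ZMod.stdAddChar (m * k)).re = n * ∑ i, f i * f (i + m) := by
    intro m
    have := parseval_shift n f m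
    simp_rw [normSq_dft] at this
    have h2 := congrArg Complex.re this
    rw [Complex.re_sum] at h2
    simp only [Complex.re_ofReal_mul] at h2
    rw [h2]
    norm_cast
  have k0 := key 0
  have k1 := key 1
  simp only [zero_mul, AddChar.map_zero_eq_one, Complex.one_re, mul_one, add_zero, one_mul] at k0 k1
  have hN0 : N 0 = 0 := by
    simp only [hN, mul_zero, AddChar.map_zero_eq_one, one_mul]
    rw [← Complex.ofReal_sum, hf]; simp
  have hle : ∑ k, N k * (ZMod.stdAddChar k).re ≤ ∑ k, N k * Real.cos (2 * Real.pi / n) := by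
    refine Finset.sum_le_sum fun k _ => ?_
    by_cases hk : k = 0
    · subst hk; simp [hN0]
    · apply mul_le_mul_of_nonneg_left _ (Complex.normSq_nonneg _)
      have : (ZMod.stdAddChar k).re = Real.cos (2 * Real.pi * k.val / n) := by
        rw [ZMod.stdAddChar_apply, ZMod.toCircle_apply]
        have : 2 * (Real.pi:ℂ) * Complex.I * (k.val:ℂ) / (n:ℂ) = ((2 * Real.pi * k.val / n : ℝ) : ℂ) * Complex.I := by
          push_cast; ring
        rw [this, Complex.exp_ofReal_mul_I_re]
      rw [this]
      apply cos_le_aux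
      · exact Nat.one_le_iff_ne_zero.mpr (by simpa using hk)
      · exact ZMod.val_lt k
  rw [k1, ← Finset.sum_mul, k0] at hle
  have : (n:ℝ) * ∑ j, f j * f (j + 1) ≤ n * (Real.cos (2 * Real.pi / n) * ∑ j, f j * f j) := by
    linarith
  exact le_of_mul_le_mul_left this hn

/-- the discrete version of the claim -/
lemma discrete_claim (n : ℕ) [NeZero n] (f g : ZMod n → ℝ) (hf : 0 < ∑ j, f j) (hg : 0 < ∑ j, g j)
    (a : (ZMod n → ℝ) → ℝ)
    (ha : ∀ f, a f = ∑ j, f j * f (j + 1) - Real.cos (2 * Real.pi / n) * ∑ j, f j * f j) :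
    a f / ∑ j, f j + a g / ∑ j, g j ≤ a (fun j => f j + g j) / ∑ j, (f j + g j) := by
  set S := ∑ j, f j with hS
  set T := ∑ j, g j with hT
  have hw := wirtinger n (fun j => T * f j - S * g j) (by
    rw [Finset.sum_sub_distrib, ← Finset.mul_sum, ← Finset.mul_sum]; rw [← hS, ← hT]; ring)
  rw [Finset.sum_add_distrib, ← hS, ← hT]
  simp only [ha]
  set c := Real.cos (2 * Real.pi / n)
  have e1 : ∑ j, (T * f j - S * g j) * (T * f (j+1) - S * g (j+1)) =
      T^2 * ∑ j, f j * f (j+1) - S*T * ∑ j, (f j * g (j+1) + g j * f (j+1)) + S^2 * ∑ j, g j * g (j+1) := by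
    simp only [Finset.mul_sum, ← Finset.sum_sub_distrib, ← Finset.sum_add_distrib]
    refine Finset.sum_congr rfl fun i _ => by ring
  have e2 : ∑ j, (T * f j - S * g j) * (T * f j - S * g j) =
      T^2 * ∑ j, f j * f j - S*T * (2 * ∑ j, f j * g j) + S^2 * ∑ j, g j * g j := by
    simp only [Finset.mul_sum, ← Finset.sum_sub_distrib, ← Finset.sum_add_distrib]
    refine Finset.sum_congr rfl fun i _ => by ring
  have e3 : ∑ j, (f j + g j) * (f (j+1) + g (j+1)) =
      ∑ j, f j * f (j+1) + ∑ j, (f j * g (j+1) + g j * f (j+1)) + ∑ j, g j * g (j+1) := by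
    simp only [← Finset.sum_add_distrib]
    refine Finset.sum_congr rfl fun i _ => by ring
  have e4 : ∑ j, (f j + g j) * (f j + g j) =
      ∑ j, f j * f j + (2 * ∑ j, f j * g j) + ∑ j, g j * g j := by
    simp only [Finset.mul_sum, ← Finset.sum_add_distrib]
    refine Finset.sum_congr rfl fun i _ => by ring
  rw [e1, e2] at hw
  rw [e3, e4]
  generalize (∑ j, f j * f (j+1)) = x1 at *
  generalize (∑ j, g j * g (j+1)) = x2 at *
  generalize (∑ j, (f j * g (j+1) + g j * f (j+1))) = x3 at *
  generalize (∑ j, f j * f j) = y1 at *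
  generalize (∑ j, g j * g j) = y2 at *
  generalize (2 * ∑ j, f j * g j) = y3 at *
  rw [div_add_div _ _ hf.ne' hg.ne', div_le_div_iff₀ (by positivity) (by positivity)]
  nlinarith

/-! ### Coordinates in the plane -/

/-- the plane -/
abbrev Pl := EuclideanSpace ℝ (Fin 2)

/-- coordinate in direction `φ` -/
def pr (φ : ℝ) (x : Pl) : ℝ := x 0 * Real.cos φ + x 1 * Real.sin φ

/-- coordinate orthogonal to direction `φ` -/
def prq (φ : ℝ) (x : Pl) : ℝ := -(x 0 * Real.sin φ) + x 1 * Real.cos φ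

/-- point with given coordinates -/
def pt (φ p q : ℝ) : Pl := !₂[p * Real.cos φ - q * Real.sin φ, p * Real.sin φ + q * Real.cos φ]

lemma pr_pt (φ p q : ℝ) : pr φ (pt φ p q) = p := by
  simp only [pr, pt]
  simp
  linear_combination p * Real.sin_sq_add_cos_sq φ

lemma prq_pt (φ p q : ℝ) : prq φ (pt φ p q) = q := by
  simp only [prq, pt]
  simp
  linear_combination q * Real.sin_sq_add_cos_sq φ

lemma pt_pr (φ : ℝ) (x : Pl) : pt φ (pr φ x) (prq φ x) = x := by
  ext i
  fin_cases i
  · simp [pr, prq, pt]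
    linear_combination x 0 * Real.sin_sq_add_cos_sq φ
  · simp [pr, prq, pt]
    linear_combination x 1 * Real.sin_sq_add_cos_sq φ

lemma pr_add_angle (φ d : ℝ) (x : Pl) :
    pr (φ + d) x = pr φ x * Real.cos d + prq φ x * Real.sin d := by
  simp only [pr, prq, Real.cos_add, Real.sin_add]; ring

lemma pr_periodic (x : Pl) : Function.Periodic (fun φ => pr φ x) (2 * Real.pi) := by
  intro φ; simp [pr]

lemma pr_add (φ : ℝ) (x y : Pl) : pr φ (x + y) = pr φ x + pr φ y := by
  simp [pr]; ring

lemma pr_sub (φ : ℝ) (x y : Pl) : pr φ (x - y) = pr φ x - pr φ y := by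
  simp [pr]; ring

lemma pr_smul (φ c : ℝ) (x : Pl) : pr φ (c • x) = c * pr φ x := by
  simp [pr]; ring

lemma pr_zero (φ : ℝ) : pr φ 0 = 0 := by simp [pr]

lemma continuous_pr (φ : ℝ) : Continuous (pr φ) := by
  unfold pr; fun_prop

lemma continuous_prq (φ : ℝ) : Continuous (prq φ) := by
  unfold prq; fun_prop

lemma abs_pr_le (φ : ℝ) (x : Pl) : |pr φ x| ≤ ‖x‖ := by
  rw [EuclideanSpace.norm_eq]
  apply Real.le_sqrt_of_sq_le
  simp [pr]
  nlinarith [sq_nonneg (x 0 * Real.sin φ - x 1 * Real.cos φ), Real.sin_sq_add_cos_sq φ, sq_nonneg (x 0),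
    sq_nonneg (x 1), mul_comm (x 0) (x 0)]

lemma exists_angle (x : Pl) : ∃ φ, x = pt φ ‖x‖ 0 := by
  refine ⟨Complex.arg ⟨x 0, x 1⟩, ?_⟩
  have hn : ‖x‖ = ‖(⟨x 0, x 1⟩ : ℂ)‖ := by
    rw [EuclideanSpace.norm_eq, Complex.norm_def]
    simp [Complex.normSq_apply]; congr 1; ring
  rw [hn]
  ext i
  fin_cases i
  · simp [pt]
  · simp [pt]

lemma pt_dist (φ p q p' q' : ℝ) : dist (pt φ p q) (pt φ p' q') = √((p - p')^2 + (q-q')^2) := by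
  rw [EuclideanSpace.dist_eq]
  congr 1
  simp [pt, Real.dist_eq]
  linear_combination ((p-p')^2 + (q-q')^2) * Real.sin_sq_add_cos_sq φ

lemma measure_seg (φ c α β : ℝ) :
    μH[(1:ℝ)] {x : Pl | pr φ x = c ∧ α ≤ prq φ x ∧ prq φ x ≤ β} = ENNReal.ofReal (β - α) := by
  have hi : Isometry (fun t : ℝ => pt φ c t) := by
    refine Isometry.of_dist_eq fun s t => ?_
    rw [pt_dist, Real.dist_eq]
    simp [Real.sqrt_sq_eq_abs]
  have : {x : Pl | pr φ x = c ∧ α ≤ prq φ x ∧ prq φ x ≤ β} = (fun t : ℝ => pt φ c t) '' Icc α β := by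
    ext x; constructor
    · rintro ⟨h1, h2, h3⟩
      exact ⟨prq φ x, ⟨h2, h3⟩, by simp only [← h1]; exact pt_pr φ x⟩
    · rintro ⟨t, ⟨h1, h2⟩, rfl⟩
      simp [pr_pt, prq_pt, h1, h2]
  rw [this, hi.hausdorffMeasure_image (Or.inl zero_le_one), hausdorffMeasure_real, Real.volume_Icc]

lemma meas_tri (c α β : ℝ) :
    MeasurableSet {y : ℝ × ℝ | 0 < y.1 ∧ y.1 ≤ c ∧ α * y.1 ≤ y.2 ∧ y.2 ≤ β * y.1} := by
  measurability

lemma volume_tri (c α β : ℝ) (hc : 0 < c) (h : α ≤ β) :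
    volume {y : ℝ × ℝ | 0 < y.1 ∧ y.1 ≤ c ∧ α * y.1 ≤ y.2 ∧ y.2 ≤ β * y.1} =
      ENNReal.ofReal (c^2 / 2 * (β - α)) := by
  have hm : MeasurableSet {y : ℝ × ℝ | 0 < y.1 ∧ y.1 ≤ c ∧ α * y.1 ≤ y.2 ∧ y.2 ≤ β * y.1} :=
    meas_tri c α β
  rw [Measure.volume_eq_prod, Measure.prod_apply hm]
  have : ∀ x : ℝ, volume (Prod.mk x ⁻¹' {y : ℝ × ℝ | 0 < y.1 ∧ y.1 ≤ c ∧ α * y.1 ≤ y.2 ∧ y.2 ≤ β * y.1})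
      = (Ioc 0 c).indicator (fun x => ENNReal.ofReal ((β - α) * x)) x := by
    intro x
    by_cases hx : x ∈ Ioc 0 c
    · rw [indicator_of_mem hx]
      have : Prod.mk x ⁻¹' {y : ℝ × ℝ | 0 < y.1 ∧ y.1 ≤ c ∧ α * y.1 ≤ y.2 ∧ y.2 ≤ β * y.1} =
          Icc (α * x) (β * x) := by
        ext y; simp [hx.1, hx.2]
      rw [this, Real.volume_Icc]; congr 1; ring
    · rw [indicator_of_notMem hx]
      have : Prod.mk x ⁻¹' {y : ℝ × ℝ | 0 < y.1 ∧ y.1 ≤ c ∧ α * y.1 ≤ y.2 ∧ y.2 ≤ β * y.1} = ∅ := by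
        ext y; simp only [mem_preimage, mem_ofPred_eq, mem_empty_iff_false, iff_false]
        rintro ⟨h1, h2, -⟩; exact hx ⟨h1, h2⟩
      rw [this, measure_empty]
  simp_rw [this]
  rw [lintegral_indicator measurableSet_Ioc, ← ofReal_integral_eq_lintegral_ofReal]
  · rw [← intervalIntegral.integral_of_le hc.le, intervalIntegral.integral_const_mul, integral_id]
    congr 1; ring
  · exact (Continuous.integrableOn_Ioc (by fun_prop))
  · refine (ae_restrict_mem measurableSet_Ioc).mono fun x hx => ?_
    exact mul_nonneg (by linarith) hx.1.le

lemma measure_tri : ∃ κ : ℝ≥0∞, κ ≠ 0 ∧ κ ≠ ∞ ∧ ∀ (φ c α β : ℝ), 0 < c → α ≤ β →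
    μH[(2:ℝ)] {x : Pl | 0 < pr φ x ∧ pr φ x ≤ c ∧ α * pr φ x ≤ prq φ x ∧ prq φ x ≤ β * pr φ x} =
      κ * ENNReal.ofReal (c^2 / 2 * (β - α)) := by
  have : Measure.IsAddHaarMeasure (μH[(2:ℝ)] : Measure Pl) := by
    have := isAddHaarMeasure_hausdorffMeasure (E := Pl)
    simpa using this
  have hs := Measure.isAddLeftInvariant_eq_smul (μH[(2:ℝ)] : Measure Pl) volume
  set k := Measure.addHaarScalarFactor (μH[(2:ℝ)] : Measure Pl) volume
  have hk : k ≠ 0 := (Measure.addHaarScalarFactor_pos_of_isAddHaarMeasure _ _).ne'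
  refine ⟨k, by simpa using hk, by simp, ?_⟩
  intro φ c α β hc h
  have hi : Isometry (fun x : Pl => pt φ (x 0) (x 1)) := by
    refine Isometry.of_dist_eq fun s t => ?_
    rw [pt_dist, EuclideanSpace.dist_eq]
    simp [Real.dist_eq]
  have : {x : Pl | 0 < pr φ x ∧ pr φ x ≤ c ∧ α * pr φ x ≤ prq φ x ∧ prq φ x ≤ β * pr φ x} =
     (fun x : Pl => pt φ (x 0) (x 1)) '' {x | 0 < x 0 ∧ x 0 ≤ c ∧ α * x 0 ≤ x 1 ∧ x 1 ≤ β * x 0} := by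
    ext x; constructor
    · intro hx
      refine ⟨!₂[pr φ x, prq φ x], ?_, ?_⟩
      · simpa using hx
      · simpa using pt_pr φ x
    · rintro ⟨y, hy, rfl⟩
      simpa [pr_pt, prq_pt] using hy
  rw [this, hi.hausdorffMeasure_image (Or.inl zero_le_two), hs, Measure.smul_apply]
  have hmp := (volume_preserving_finTwoArrow ℝ).comp (PiLp.volume_preserving_ofLp (Fin 2))
  have := hmp.measure_preimage (s := {y : ℝ × ℝ | 0 < y.1 ∧ y.1 ≤ c ∧ α * y.1 ≤ y.2 ∧ y.2 ≤ β * y.1})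
    (meas_tri c α β).nullMeasurableSet
  rw [volume_tri c α β hc h] at this
  rw [← this]
  rfl

/-! ### Support functions -/

/-- `H` is the support function of `K` in terms of angles -/
def IsSupp (K : Set Pl) (H : ℝ → ℝ) : Prop :=
  (∀ φ, ∀ x ∈ K, pr φ x ≤ H φ) ∧ ∀ φ, ∃ x ∈ K, pr φ x = H φ

lemma exists_supp (K : Set Pl) (hK : IsCompact K) (hne : K.Nonempty) : ∃ H, IsSupp K H := by
  have : ∀ φ, ∃ x ∈ K, ∀ y ∈ K, pr φ y ≤ pr φ x := fun φ =>
    hK.exists_isMaxOn hne (continuous_pr φ).continuousOn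
  choose x hx hm using this
  exact ⟨fun φ => pr φ (x φ), fun φ y hy => hm φ y hy, fun φ => ⟨x φ, hx φ, rfl⟩⟩

lemma IsSupp.add {K L : Set Pl} {H G : ℝ → ℝ} (hK : IsSupp K H) (hL : IsSupp L G) :
    IsSupp (K + L) (fun φ => H φ + G φ) := by
  constructor
  · rintro φ _ ⟨x, hx, y, hy, rfl⟩
    simp only [pr_add]
    exact add_le_add (hK.1 φ x hx) (hL.1 φ y hy)
  · intro φ
    obtain ⟨x, hx, hx'⟩ := hK.2 φ
    obtain ⟨y, hy, hy'⟩ := hL.2 φ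
    exact ⟨x + y, ⟨x, hx, y, hy, rfl⟩, by rw [pr_add, hx', hy']⟩

lemma IsSupp.periodic {K : Set Pl} {H : ℝ → ℝ} (hK : IsSupp K H) :
    Function.Periodic H (2 * Real.pi) := by
  intro φ
  have e : ∀ x, pr (φ + 2 * Real.pi) x = pr φ x := fun x => pr_periodic x φ
  apply le_antisymm
  · obtain ⟨x, hx, h⟩ := hK.2 (φ + 2 * Real.pi)
    rw [← h, e]; exact hK.1 _ _ hx
  · obtain ⟨x, hx, h⟩ := hK.2 φ
    rw [← h, ← e]; exact hK.1 _ _ hx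

lemma IsSupp.pos {K : Set Pl} {H : ℝ → ℝ} (hK : IsSupp K H) {r : ℝ} (hr : 0 < r)
    (hb : Metric.closedBall 0 r ⊆ K) (φ : ℝ) : r ≤ H φ := by
  have : pt φ r 0 ∈ K := by
    apply hb
    have e : (0 : Pl) = pt φ 0 0 := by ext i; fin_cases i <;> simp [pt]
    rw [Metric.mem_closedBall, e, pt_dist]
    simp [Real.sqrt_sq hr.le]
  have h := hK.1 φ _ this
  rwa [pr_pt] at h

/-- subadditivity in trigonometric form -/
lemma IsSupp.trig {K : Set Pl} {H : ℝ → ℝ} (hK : IsSupp K H) (φ a b : ℝ) (ha : 0 ≤ Real.sin a)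
    (hb : 0 ≤ Real.sin b) :
    H φ * Real.sin (a + b) ≤ Real.sin b * H (φ - a) + Real.sin a * H (φ + b) := by
  obtain ⟨x, hx, h⟩ := hK.2 φ
  have h1 := mul_le_mul_of_nonneg_left (hK.1 (φ - a) x hx) hb
  have h2 := mul_le_mul_of_nonneg_left (hK.1 (φ + b) x hx) ha
  rw [sub_eq_add_neg, pr_add_angle, Real.cos_neg, Real.sin_neg] at h1
  rw [pr_add_angle] at h2
  rw [← h, Real.sin_add, sub_eq_add_neg]
  nlinarith

/-- position of the end of the face in direction `φ` -/
def sl (H : ℝ → ℝ) (δ φ : ℝ) : ℝ := (H (φ + δ) - H φ * Real.cos δ) / Real.sin δ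

lemma sl_neg (H : ℝ → ℝ) (δ φ : ℝ) :
    sl H (-δ) φ = -((H (φ - δ) - H φ * Real.cos δ) / Real.sin δ) := by
  simp [sl, div_neg, sub_eq_add_neg]

lemma sl_len (H : ℝ → ℝ) (δ φ : ℝ) :
    sl H δ φ - sl H (-δ) φ = (H (φ + δ) + H (φ - δ) - 2 * H φ * Real.cos δ) / Real.sin δ := by
  rw [sl_neg, sl]; ring

lemma IsSupp.sl_le {K : Set Pl} {H : ℝ → ℝ} (hK : IsSupp K H) {δ : ℝ} (hd : 0 < Real.sin δ) (φ : ℝ) :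
    sl H (-δ) φ ≤ sl H δ φ := by
  rw [← sub_nonneg, sl_len]
  apply div_nonneg _ hd.le
  have := hK.trig φ δ δ hd.le hd.le
  rw [Real.sin_add] at this
  nlinarith

/-- constraints at `φ ± δ` in terms of `sl` -/
lemma le_sl {H : ℝ → ℝ} {δ : ℝ} (hd : 0 < Real.sin δ) (φ : ℝ) (x : Pl)
    (h1 : pr (φ + δ) x * H φ ≤ H (φ + δ) * pr φ x) (h2 : pr (φ - δ) x * H φ ≤ H (φ - δ) * pr φ x) :
    sl H (-δ) φ * pr φ x ≤ prq φ x * H φ ∧ prq φ x * H φ ≤ sl H δ φ * pr φ x := by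
  rw [sub_eq_add_neg, pr_add_angle, Real.cos_neg, Real.sin_neg, ← sub_eq_add_neg] at h2
  rw [pr_add_angle] at h1
  constructor
  · rw [sl_neg, neg_mul, div_mul_eq_mul_div, neg_le, le_div_iff₀ hd]
    linarith
  · rw [sl, div_mul_eq_mul_div, le_div_iff₀ hd]
    linarith

/-- points on the cone over a face satisfy all the other constraints -/
lemma IsSupp.face {K : Set Pl} {H : ℝ → ℝ} (hK : IsSupp K H) {δ : ℝ} (hd : 0 < Real.sin δ) (φ : ℝ) (x : Pl)
    (hx : 0 ≤ pr φ x) (h1 : sl H (-δ) φ * pr φ x ≤ prq φ x * H φ) (h2 : prq φ x * H φ ≤ sl H δ φ * pr φ x)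
    (d : ℝ) (hd' : (δ ≤ d ∧ d ≤ Real.pi ∧ 0 ≤ δ) ∨ (δ ≤ -d ∧ -d ≤ Real.pi ∧ 0 ≤ δ)) :
    pr (φ + d) x * H φ ≤ H (φ + d) * pr φ x := by
  rw [pr_add_angle]
  rcases hd' with ⟨h3, h4, h0⟩ | ⟨h3, h4, h0⟩
  · have s1 : 0 ≤ Real.sin (d - δ) := Real.sin_nonneg_of_nonneg_of_le_pi (by linarith) (by linarith)
    have s2 : 0 ≤ Real.sin d := Real.sin_nonneg_of_nonneg_of_le_pi (by linarith) (by linarith)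
    have := hK.trig (φ + δ) δ (d - δ) hd.le s1
    rw [show δ + (d - δ) = d by ring, show φ + δ - δ = φ by ring, show φ + δ + (d - δ) = φ + d by ring,
      Real.sin_sub] at this
    rw [sl, div_mul_eq_mul_div, le_div_iff₀ hd] at h2
    have h5 := mul_le_mul_of_nonneg_right h2 s2
    have h6 := mul_le_mul_of_nonneg_right this hx
    refine le_of_mul_le_mul_right ?_ hd
    nlinarith
  · have s1 : 0 ≤ Real.sin (-d - δ) := Real.sin_nonneg_of_nonneg_of_le_pi (by linarith) (by linarith)
    have s2 : 0 ≤ Real.sin (-d) := Real.sin_nonneg_of_nonneg_of_le_pi (by linarith) (by linarith)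
    have := hK.trig (φ - δ) (-d - δ) δ s1 hd.le
    rw [show -d - δ + δ = -d by ring, show φ - δ + δ = φ by ring, show φ - δ - (-d - δ) = φ + d by ring,
      Real.sin_sub, Real.cos_neg] at this
    rw [sl_neg, neg_mul, div_mul_eq_mul_div, neg_le, le_div_iff₀ hd] at h1
    have h5 := mul_le_mul_of_nonneg_right h1 s2
    have h6 := mul_le_mul_of_nonneg_right this hx
    rw [Real.sin_neg] at h5 h6 s2
    refine le_of_mul_le_mul_right ?_ hd
    nlinarith

/-! ### The angles -/

/-- the angles of the polygon -/
def th (n : ℕ) (k : ZMod n) : ℝ := k.val * (2 * Real.pi / n)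

lemma th_succ {n : ℕ} [NeZero n] (hn : 2 ≤ n) {g : ℝ → ℝ} (hg : Function.Periodic g (2 * Real.pi)) (k : ZMod n) :
    g (th n (k + 1)) = g (th n k + 2 * Real.pi / n) := by
  have hn' : (n:ℝ) ≠ 0 := by exact_mod_cast NeZero.ne n
  have h1 : (1 : ZMod n).val = 1 := by
    have : Fact (1 < n) := ⟨hn⟩
    exact ZMod.val_one n
  have h2 := Nat.mod_add_div (k.val + 1) n
  have : th n k + 2 * Real.pi / n = th n (k+1) + ((k.val + 1) / n : ℕ) * (2 * Real.pi) := by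
    rw [th, th, ZMod.val_add, h1]
    have h3 : (((k.val + 1) % n : ℕ) : ℝ) = k.val + 1 - n * ((k.val + 1) / n : ℕ) := by
      rw [eq_sub_iff_add_eq]; exact_mod_cast h2
    rw [h3]; field_simp; ring
  rw [this, hg.nat_mul]

lemma th_pred {n : ℕ} [NeZero n] (hn : 2 ≤ n) {g : ℝ → ℝ} (hg : Function.Periodic g (2 * Real.pi)) (k : ZMod n) :
    g (th n (k - 1)) = g (th n k - 2 * Real.pi / n) := by
  have hg' : Function.Periodic (fun t => g (t - 2 * Real.pi / n)) (2 * Real.pi) := by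
    intro t
    have := hg (t - 2 * Real.pi / n)
    simp only
    rw [← this]; congr 1; ring
  have := th_succ hn hg' (k - 1)
  simp only [sub_add_cancel, add_sub_cancel_right] at this
  exact this.symm

lemma th_bounds {n : ℕ} [NeZero n] (k : ZMod n) : 0 ≤ th n k ∧ th n k < 2 * Real.pi := by
  have hn' : (0:ℝ) < n := by exact_mod_cast Nat.pos_of_ne_zero (NeZero.ne n)
  have := Real.pi_pos
  refine ⟨by unfold th; positivity, ?_⟩
  have : (k.val : ℝ) < n := by exact_mod_cast ZMod.val_lt k
  unfold th
  rw [mul_div_assoc', div_lt_iff₀ hn']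
  nlinarith

lemma th_inj {n : ℕ} [NeZero n] {j k : ZMod n} (h : th n j = th n k) : j = k := by
  have hn' : (n:ℝ) ≠ 0 := by exact_mod_cast NeZero.ne n
  have := Real.pi_pos
  unfold th at h
  have h2 := mul_right_cancel₀ (by positivity) h
  exact ZMod.val_injective n (by exact_mod_cast h2)

lemma th_inj' {n : ℕ} [NeZero n] {j k : ZMod n} (h : Real.cos (th n j - th n k) = 1) : j = k := by
  obtain ⟨h1, h2⟩ := th_bounds j
  obtain ⟨h3, h4⟩ := th_bounds k
  have := (Real.cos_eq_one_iff_of_lt_of_lt (by linarith) (by linarith)).1 h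
  exact th_inj (by linarith)

/-- the difference of two different angles is at least `2π/n` modulo `2π` -/
lemma th_diff {n : ℕ} [NeZero n] {j k : ZMod n} (h : j ≠ k) : ∃ d : ℝ,
    (∀ g : ℝ → ℝ, Function.Periodic g (2 * Real.pi) → g (th n j) = g (th n k + d)) ∧
    ((2 * Real.pi / n ≤ d ∧ d ≤ Real.pi) ∨ (2 * Real.pi / n ≤ -d ∧ -d ≤ Real.pi)) := by
  have hn' : (0:ℝ) < n := by exact_mod_cast Nat.pos_of_ne_zero (NeZero.ne n)
  have hpi := Real.pi_pos
  have key : ∀ v w : ℕ, v < w → w < n → ∃ d : ℝ,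
    (∀ g : ℝ → ℝ, Function.Periodic g (2 * Real.pi) →
      (∀ t, g (t + w * (2 * Real.pi / n)) = g (t + v * (2 * Real.pi / n) + d))) ∧
    ((2 * Real.pi / n ≤ d ∧ d ≤ Real.pi) ∨ (2 * Real.pi / n ≤ -d ∧ -d ≤ Real.pi)) := by
    intro v w hvw hw
    have h1 : (v:ℝ) + 1 ≤ w := by exact_mod_cast hvw
    have h2 : (w:ℝ) + 1 ≤ n := by exact_mod_cast hw
    have h0 : (0:ℝ) ≤ v := by positivity
    by_cases hc : 2 * ((w:ℝ) - v) ≤ n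
    · refine ⟨(w - v) * (2 * Real.pi / n), fun g _ t => by congr 1; ring, Or.inl ⟨?_, ?_⟩⟩
      · have : 0 < 2 * Real.pi / n := by positivity
        nlinarith
      · rw [mul_div_assoc', div_le_iff₀ hn']; nlinarith
    · refine ⟨(w - v) * (2 * Real.pi / n) - 2 * Real.pi, fun g hg t => ?_, Or.inr ⟨?_, ?_⟩⟩
      · rw [← hg (t + v * (2 * Real.pi / n) + ((w - v) * (2 * Real.pi / n) - 2 * Real.pi))]; congr 1; ring
      · have e : -((w - v) * (2 * Real.pi / n) - 2 * Real.pi) = (n - (w - v)) * (2 * Real.pi / n) := by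
          field_simp
          ring
        rw [e]
        have : 0 < 2 * Real.pi / n := by positivity
        nlinarith
      · have e : -((w - v) * (2 * Real.pi / n) - 2 * Real.pi) = (n - (w - v)) * (2 * Real.pi) / n := by
          field_simp
          ring
        rw [e, div_le_iff₀ hn']; nlinarith
  have hne : j.val ≠ k.val := fun e => h (ZMod.val_injective n e)
  rcases lt_or_gt_of_ne hne with hlt | hlt
  · obtain ⟨d, h1, h2⟩ := key _ _ hlt (ZMod.val_lt k)
    refine ⟨-d, fun g hg => ?_, ?_⟩
    · have := h1 g hg (-d)
      rw [th, th, add_comm (_ * _) (-d), this]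
      congr 1; ring
    · rw [neg_neg]; exact h2.symm
  · obtain ⟨d, h1, h2⟩ := key _ _ hlt (ZMod.val_lt j)
    refine ⟨d, fun g hg => ?_, h2⟩
    have := h1 g hg 0
    simpa [th] using this

/-! ### The circumscribed polygon -/

/-- circumscribed polygon -/
def poly (n : ℕ) (H : ℝ → ℝ) : Set Pl := {x | ∀ k : ZMod n, pr (th n k) x ≤ H (th n k)}

/-- triangle over a face -/
def tri (n : ℕ) (H : ℝ → ℝ) (k : ZMod n) : Set Pl :=
  {x | 0 < pr (th n k) x ∧ pr (th n k) x ≤ H (th n k) ∧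
    sl H (-(2 * Real.pi / n)) (th n k) / H (th n k) * pr (th n k) x ≤ prq (th n k) x ∧
    prq (th n k) x ≤ sl H (2 * Real.pi / n) (th n k) / H (th n k) * pr (th n k) x}

/-- face -/
def fc (n : ℕ) (H : ℝ → ℝ) (k : ZMod n) : Set Pl :=
  {x | pr (th n k) x = H (th n k) ∧
    sl H (-(2 * Real.pi / n)) (th n k) ≤ prq (th n k) x ∧
    prq (th n k) x ≤ sl H (2 * Real.pi / n) (th n k)}

lemma sin_pos_n {n : ℕ} (hn : 3 ≤ n) : 0 < Real.sin (2 * Real.pi / n) ∧ 0 ≤ 2 * Real.pi / n := by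
  have hn' : (3:ℝ) ≤ n := by exact_mod_cast hn
  have := Real.pi_pos
  refine ⟨Real.sin_pos_of_pos_of_lt_pi (by positivity) ?_, by positivity⟩
  rw [div_lt_iff₀ (by linarith)]; nlinarith

section
variable {K : Set Pl} {H : ℝ → ℝ} {n : ℕ} [NeZero n]

lemma cone_spec (hK : IsSupp K H) (hn : 3 ≤ n) (k : ZMod n) (x : Pl)
    (hx : 0 ≤ pr (th n k) x)
    (h1 : sl H (-(2 * Real.pi / n)) (th n k) * pr (th n k) x ≤ prq (th n k) x * H (th n k))
    (h2 : prq (th n k) x * H (th n k) ≤ sl H (2 * Real.pi / n) (th n k) * pr (th n k) x) (j : ZMod n) :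
    pr (th n j) x * H (th n k) ≤ H (th n j) * pr (th n k) x := by
  by_cases h : j = k
  · subst h; rw [mul_comm]
  obtain ⟨hs, h0⟩ := sin_pos_n hn
  obtain ⟨d, hd1, hd2⟩ := th_diff h
  have e1 := hd1 _ (pr_periodic x)
  have e2 := hd1 _ hK.periodic
  rw [e1, e2]
  apply hK.face hs _ x hx h1 h2
  rcases hd2 with ⟨a, b⟩ | ⟨a, b⟩
  · exact Or.inl ⟨a, b, h0⟩
  · exact Or.inr ⟨a, b, h0⟩

lemma tri_spec (hK : IsSupp K H) (hp : ∀ φ, 0 < H φ) (hn : 3 ≤ n) {k : ZMod n} {x : Pl}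
    (hx : x ∈ tri n H k) (j : ZMod n) :
    pr (th n j) x * H (th n k) ≤ H (th n j) * pr (th n k) x := by
  obtain ⟨h1, h2, h3, h4⟩ := hx
  refine cone_spec hK hn k x h1.le ?_ ?_ j
  · rwa [div_mul_eq_mul_div, div_le_iff₀ (hp _)] at h3
  · rwa [div_mul_eq_mul_div, le_div_iff₀ (hp _)] at h4

lemma mem_tri_of (hK : IsSupp K H) (hp : ∀ φ, 0 < H φ) (hn : 3 ≤ n) {k : ZMod n} {x : Pl}
    (h0 : 0 < pr (th n k) x) (h1 : pr (th n k) x ≤ H (th n k))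
    (h : ∀ j, pr (th n j) x * H (th n k) ≤ H (th n j) * pr (th n k) x) : x ∈ tri n H k := by
  obtain ⟨hs, -⟩ := sin_pos_n hn
  have a1 := h (k + 1)
  have a2 := h (k - 1)
  have e1 := th_succ (by omega) (pr_periodic x) k
  have e2 := th_pred (by omega) (pr_periodic x) k
  rw [e1, th_succ (by omega) hK.periodic] at a1
  rw [e2, th_pred (by omega) hK.periodic] at a2
  have := le_sl hs (th n k) x a1 a2
  refine ⟨h0, h1, ?_, ?_⟩
  · rw [div_mul_eq_mul_div, div_le_iff₀ (hp _)]; exact this.1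
  · rw [div_mul_eq_mul_div, le_div_iff₀ (hp _)]; exact this.2

lemma tri_sub_poly (hK : IsSupp K H) (hp : ∀ φ, 0 < H φ) (hn : 3 ≤ n) (k : ZMod n) :
    tri n H k ⊆ poly n H := by
  intro x hx j
  have := tri_spec hK hp hn hx j
  have h2 := mul_le_mul_of_nonneg_left hx.2.1 (hp (th n j)).le
  exact le_of_mul_le_mul_right (this.trans h2) (hp _)

lemma sub_poly (hK : IsSupp K H) : K ⊆ poly n H := fun x hx k => hK.1 _ x hx

lemma poly_sub_iUnion (hK : IsSupp K H) (hp : ∀ φ, 0 < H φ) (hn : 3 ≤ n) :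
    poly n H ⊆ {0} ∪ ⋃ k, tri n H k := by
  intro x hx
  by_cases hx0 : x = 0
  · left; exact hx0
  right
  obtain ⟨k, hk⟩ := Finite.exists_max (fun k : ZMod n => pr (th n k) x / H (th n k))
  have hspec : ∀ j, pr (th n j) x * H (th n k) ≤ H (th n j) * pr (th n k) x := by
    intro j
    have := hk j
    rw [div_le_div_iff₀ (hp _) (hp _)] at this
    linarith
  refine mem_iUnion.2 ⟨k, mem_tri_of hK hp hn ?_ (hx k) hspec⟩
  by_contra hneg
  push Not at hneg
  have hall : ∀ j, pr (th n j) x ≤ 0 := by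
    intro j
    have := hspec j
    by_contra hc
    push Not at hc
    have h1 : 0 < pr (th n j) x * H (th n k) := mul_pos hc (hp _)
    have h2 : H (th n j) * pr (th n k) x ≤ 0 := mul_nonpos_of_nonneg_of_nonpos (hp _).le hneg
    linarith
  -- the sum of all coordinates is zero, hence each of them is zero
  apply hx0
  obtain ⟨hs, h0⟩ := sin_pos_n hn
  set S := ∑ j : ZMod n, pr (th n j) x with hS
  have hsum : S * (2 * Real.cos (2 * Real.pi / n)) = 2 * S := by
    have e1 : ∑ j : ZMod n, pr (th n j + 2 * Real.pi / n) x = S := by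
      rw [hS, ← Equiv.sum_comp (Equiv.addRight (1 : ZMod n)) (fun j => pr (th n j) x)]
      refine Finset.sum_congr rfl fun j _ => ?_
      exact (th_succ (by omega) (pr_periodic x) j).symm
    have e2 : ∑ j : ZMod n, pr (th n j - 2 * Real.pi / n) x = S := by
      rw [hS, ← Equiv.sum_comp (Equiv.subRight (1 : ZMod n)) (fun j => pr (th n j) x)]
      refine Finset.sum_congr rfl fun j _ => ?_
      exact (th_pred (by omega) (pr_periodic x) j).symm
    have : S * (2 * Real.cos (2 * Real.pi / n)) = S + S := by
      nth_rw 2 [← e1]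
      nth_rw 2 [← e2]
      rw [hS, Finset.sum_mul, ← Finset.sum_add_distrib]
      refine Finset.sum_congr rfl fun j _ => ?_
      rw [sub_eq_add_neg, pr_add_angle, pr_add_angle, Real.cos_neg, Real.sin_neg]; ring
    linarith
  have hcos : Real.cos (2 * Real.pi / n) ≠ 1 := by
    intro hc
    have := Real.sin_sq_add_cos_sq (2 * Real.pi / n)
    rw [hc] at this
    nlinarith
  have hS0 : S = 0 := by
    have : S * (Real.cos (2 * Real.pi / n) - 1) = 0 := by linarith
    rcases mul_eq_zero.1 this with h | h
    · exact h
    · exact absurd (by linarith) hcos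
  have hz : ∀ j : ZMod n, pr (th n j) x = 0 := by
    have := (Finset.sum_eq_zero_iff_of_nonpos (fun j _ => hall j)).1 (hS ▸ hS0)
    exact fun j => this j (Finset.mem_univ j)
  have z0 := hz 0
  have z1 := hz (0 + 1)
  have e1 := th_succ (by omega) (pr_periodic x) (0 : ZMod n)
  rw [e1, pr_add_angle, z0, zero_mul, zero_add] at z1
  have zq : prq (th n 0) x = 0 := by
    rcases mul_eq_zero.1 z1 with h | h
    · exact h
    · exact absurd h hs.ne'
  rw [← pt_pr (th n 0) x, z0, zq]
  ext i; fin_cases i <;> simp [pt]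

lemma measurable_tri (k : ZMod n) : MeasurableSet (tri n H k) := by
  have h1 := (continuous_pr (th n k)).measurable
  have h2 := (continuous_prq (th n k)).measurable
  unfold tri
  refine MeasurableSet.inter (measurableSet_lt measurable_const h1) (MeasurableSet.inter
    (measurableSet_le h1 measurable_const) (MeasurableSet.inter ?_ ?_))
  · exact measurableSet_le (h1.const_mul _) h2
  · exact measurableSet_le h2 (h1.const_mul _)

lemma isClosed_fc (k : ZMod n) : IsClosed (fc n H k) := by
  have h1 := (continuous_pr (th n k))
  have h2 := (continuous_prq (th n k))
  unfold fc
  refine IsClosed.inter (isClosed_eq h1 continuous_const) (IsClosed.inter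
    (isClosed_le continuous_const h2) (isClosed_le h2 continuous_const))

lemma isClosed_poly : IsClosed (poly n H) := by
  have : poly n H = ⋂ k, {x | pr (th n k) x ≤ H (th n k)} := by ext x; simp [poly]
  rw [this]
  exact isClosed_iInter fun k => isClosed_le (continuous_pr _) continuous_const

lemma convex_poly : Convex ℝ (poly n H) := by
  intro x hx y hy a b ha hb hab k
  rw [pr_add, pr_smul, pr_smul]
  have := mul_le_mul_of_nonneg_left (hx k) ha
  have := mul_le_mul_of_nonneg_left (hy k) hb
  have e : H (th n k) = a * H (th n k) + b * H (th n k) := by rw [← add_mul, hab, one_mul]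
  linarith

lemma haar2 : Measure.IsAddHaarMeasure (μH[(2:ℝ)] : Measure Pl) := by
  have := isAddHaarMeasure_hausdorffMeasure (E := Pl)
  simpa using this

lemma tri_disj (hK : IsSupp K H) (hp : ∀ φ, 0 < H φ) (hn : 3 ≤ n) {j k : ZMod n} (hjk : j ≠ k) :
    AEDisjoint (μH[(2:ℝ)] : Measure Pl) (tri n H j) (tri n H k) := by
  have := haar2
  let f : Pl →ₗ[ℝ] ℝ :=
    { toFun := fun x => pr (th n j) x * H (th n k) - H (th n j) * pr (th n k) x
      map_add' := fun x y => by rw [pr_add, pr_add]; ring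
      map_smul' := fun c x => by rw [pr_smul, pr_smul]; simp; ring }
  have hsub : tri n H j ∩ tri n H k ⊆ (LinearMap.ker f : Submodule ℝ Pl) := by
    rintro x ⟨hj, hk⟩
    have h1 := tri_spec hK hp hn hk j
    have h2 := tri_spec hK hp hn hj k
    simp only [SetLike.mem_coe, LinearMap.mem_ker]
    change pr (th n j) x * H (th n k) - H (th n j) * pr (th n k) x = 0
    linarith
  refine measure_mono_null hsub (Measure.addHaar_submodule _ _ ?_)
  intro htop
  have hz : ∀ x, f x = 0 := fun x => by
    have : x ∈ LinearMap.ker f := by rw [htop]; trivial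
    exact this
  have a1 := hz (pt (th n k) 1 0)
  have a2 := hz (pt (th n j) 1 0)
  change pr (th n j) _ * H (th n k) - H (th n j) * pr (th n k) _ = 0 at a1
  change pr (th n j) _ * H (th n k) - H (th n j) * pr (th n k) _ = 0 at a2
  rw [pr_pt, show th n j = th n k + (th n j - th n k) by ring, pr_add_angle, pr_pt, prq_pt,
    show th n k + (th n j - th n k) = th n j by ring] at a1
  rw [pr_pt, show th n k = th n j + -(th n j - th n k) by ring, pr_add_angle, pr_pt, prq_pt, Real.cos_neg,
    show th n j + -(th n j - th n k) = th n k by ring] at a2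
  have hj := hp (th n j)
  have hk := hp (th n k)
  apply hjk
  apply th_inj'
  set c := Real.cos (th n j - th n k)
  have hc1 : c * c = 1 := by
    have : (c * c) * H (th n j) = 1 * H (th n j) := by
      have b1 : H (th n j) = c * H (th n k) := by linarith
      have b2 : H (th n k) = H (th n j) * c := by linarith
      calc c * c * H (th n j) = c * (H (th n j) * c) := by ring
        _ = 1 * H (th n j) := by rw [← b2, ← b1, one_mul]
    exact mul_right_cancel₀ hj.ne' this
  have hc0 : 0 < c := by
    by_contra hneg
    push Not at hneg
    have := mul_nonpos_of_nonpos_of_nonneg hneg hk.le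
    linarith
  nlinarith

lemma fc_disj (hp : ∀ φ, 0 < H φ) {j k : ZMod n} (hjk : j ≠ k) :
    AEDisjoint (μH[(1:ℝ)] : Measure Pl) (fc n H j) (fc n H k) := by
  have := Measure.nullSingletonClass_hausdorff Pl (d := 1) one_pos
  apply Set.Subsingleton.measure_zero
  rintro x ⟨hxj, hxk⟩ y ⟨hyj, hyk⟩
  have e1 : pr (th n j) (x - y) = 0 := by rw [pr_sub, hxj.1, hyj.1, sub_self]
  have e2 : pr (th n k) (x - y) = 0 := by rw [pr_sub, hxk.1, hyk.1, sub_self]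
  rw [show th n j = th n k + (th n j - th n k) by ring, pr_add_angle, e2, zero_mul, zero_add] at e1
  rcases mul_eq_zero.1 e1 with h | h
  · have := pt_pr (th n k) (x - y)
    rw [e2, h] at this
    rw [← sub_eq_zero, ← this]
    ext i; fin_cases i <;> simp [pt]
  · exfalso
    have hj := hxj.1
    rw [show th n j = th n k + (th n j - th n k) by ring, pr_add_angle, hxk.1, h,
      show th n k + (th n j - th n k) = th n j by ring] at hj
    have hc := Real.sin_sq_add_cos_sq (th n j - th n k)
    rw [h] at hc
    have hc1 : Real.cos (th n j - th n k) ≠ 1 := fun h => hjk (th_inj' h)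
    have hc2 : Real.cos (th n j - th n k) = -1 := by
      have : (Real.cos (th n j - th n k) - 1) * (Real.cos (th n j - th n k) + 1) = 0 := by linarith
      rcases mul_eq_zero.1 this with h | h
      · exact absurd (by linarith) hc1
      · linarith
    rw [hc2] at hj
    have := hp (th n j)
    have := hp (th n k)
    linarith

lemma frontier_poly (hK : IsSupp K H) (hp : ∀ φ, 0 < H φ) (hn : 3 ≤ n) :
    frontier (poly n H) = ⋃ k, fc n H k := by
  obtain ⟨hs, -⟩ := sin_pos_n hn
  apply Subset.antisymm
  · intro x hx
    have hxp : x ∈ poly n H := isClosed_poly.frontier_subset hx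
    have : ∃ k : ZMod n, pr (th n k) x = H (th n k) := by
      by_contra hc
      push Not at hc
      have ho : IsOpen {x : Pl | ∀ k : ZMod n, pr (th n k) x < H (th n k)} := by
        have : {x : Pl | ∀ k : ZMod n, pr (th n k) x < H (th n k)} =
          ⋂ k : ZMod n, {x | pr (th n k) x < H (th n k)} := by ext x; simp
        rw [this]
        exact isOpen_iInter_of_finite fun k => isOpen_lt (continuous_pr _) continuous_const
      have hi : x ∈ interior (poly n H) :=
        interior_maximal (fun y hy k => (hy k).le) ho (fun k => lt_of_le_of_ne (hxp k) (hc k))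
      exact hx.2 hi
    obtain ⟨k, hk⟩ := this
    have ht := mem_tri_of hK hp hn (k := k) (x := x) (hk ▸ hp _) hk.le (fun j => by
      rw [hk]; exact mul_le_mul_of_nonneg_right (hxp j) (hp _).le)
    refine mem_iUnion.2 ⟨k, hk, ?_, ?_⟩
    · have := ht.2.2.1
      rwa [hk, div_mul_cancel₀ _ (hp _).ne'] at this
    · have := ht.2.2.2
      rwa [hk, div_mul_cancel₀ _ (hp _).ne'] at this
  · intro x hx
    obtain ⟨k, h1, h2, h3⟩ := mem_iUnion.1 hx
    have ht : x ∈ tri n H k := ⟨h1 ▸ hp _, h1.le, by rwa [h1, div_mul_cancel₀ _ (hp _).ne'],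
      by rwa [h1, div_mul_cancel₀ _ (hp _).ne']⟩
    refine ⟨subset_closure (tri_sub_poly hK hp hn k ht), fun hi => ?_⟩
    have hc : ContinuousAt (fun t : ℝ => x + t • pt (th n k) 1 0) 0 := by fun_prop
    have hm : interior (poly n H) ∈ nhds (x + (0:ℝ) • pt (th n k) 1 0) := by
      rw [zero_smul, add_zero]; exact isOpen_interior.mem_nhds hi
    have hev := hc.preimage_mem_nhds hm
    obtain ⟨ε, he, hb⟩ := Metric.mem_nhds_iff.1 hev
    have hmem : (ε / 2) ∈ Metric.ball (0:ℝ) ε := by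
      simp [abs_of_pos he]; exact he
    have := interior_subset (hb hmem) k
    rw [pr_add, pr_smul, pr_pt, h1] at this
    linarith

lemma measure_frontier_poly (hK : IsSupp K H) (hp : ∀ φ, 0 < H φ) (hn : 3 ≤ n) :
    μH[(1:ℝ)] (frontier (poly n H)) = ENNReal.ofReal ((2 - 2 * Real.cos (2 * Real.pi / n)) /
      Real.sin (2 * Real.pi / n) * ∑ k : ZMod n, H (th n k)) := by
  obtain ⟨hs, -⟩ := sin_pos_n hn
  rw [frontier_poly hK hp hn, measure_iUnion₀ (fun j k hjk => fc_disj hp hjk)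
    (fun k => (isClosed_fc k).measurableSet.nullMeasurableSet), tsum_fintype]
  have : ∀ k : ZMod n, μH[(1:ℝ)] (fc n H k) = ENNReal.ofReal
      (sl H (2 * Real.pi / n) (th n k) - sl H (-(2 * Real.pi / n)) (th n k)) := fun k => measure_seg _ _ _ _
  simp_rw [this]
  rw [← ENNReal.ofReal_sum_of_nonneg (fun k _ => sub_nonneg.2 (hK.sl_le hs _))]
  congr 1
  simp_rw [sl_len]
  rw [← Finset.sum_div, Finset.sum_sub_distrib, Finset.sum_add_distrib]
  have e1 : ∑ j : ZMod n, H (th n j + 2 * Real.pi / n) = ∑ k : ZMod n, H (th n k) := by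
    rw [← Equiv.sum_comp (Equiv.addRight (1 : ZMod n)) (fun j => H (th n j))]
    exact Finset.sum_congr rfl fun j _ => (th_succ (by omega) hK.periodic j).symm
  have e2 : ∑ j : ZMod n, H (th n j - 2 * Real.pi / n) = ∑ k : ZMod n, H (th n k) := by
    rw [← Equiv.sum_comp (Equiv.subRight (1 : ZMod n)) (fun j => H (th n j))]
    exact Finset.sum_congr rfl fun j _ => (th_pred (by omega) hK.periodic j).symm
  rw [e1, e2, ← Finset.sum_mul, ← Finset.mul_sum]
  ring

lemma measure_poly (hK : IsSupp K H) (hp : ∀ φ, 0 < H φ) (hn : 3 ≤ n) (κ : ℝ≥0∞)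
    (hκ : ∀ (φ c α β : ℝ), 0 < c → α ≤ β →
    μH[(2:ℝ)] {x : Pl | 0 < pr φ x ∧ pr φ x ≤ c ∧ α * pr φ x ≤ prq φ x ∧ prq φ x ≤ β * pr φ x} =
      κ * ENNReal.ofReal (c^2 / 2 * (β - α))) :
    μH[(2:ℝ)] (poly n H) = κ * ENNReal.ofReal ((∑ k : ZMod n, H (th n k) * H (th n (k + 1)) -
      Real.cos (2 * Real.pi / n) * ∑ k : ZMod n, H (th n k) * H (th n k)) / Real.sin (2 * Real.pi / n)) := by
  obtain ⟨hs, -⟩ := sin_pos_n hn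
  have := Measure.nullSingletonClass_hausdorff Pl (d := 2) two_pos
  have e0 : μH[(2:ℝ)] (poly n H) = μH[(2:ℝ)] (⋃ k, tri n H k) := by
    apply le_antisymm
    · refine (measure_mono (poly_sub_iUnion hK hp hn)).trans ((measure_union_le _ _).trans ?_)
      rw [measure_singleton, zero_add]
    · exact measure_mono (iUnion_subset fun k => tri_sub_poly hK hp hn k)
  rw [e0, measure_iUnion₀ (fun j k hjk => tri_disj hK hp hn hjk)
    (fun k => (measurable_tri k).nullMeasurableSet), tsum_fintype]
  have : ∀ k : ZMod n, μH[(2:ℝ)] (tri n H k) = κ * ENNReal.ofReal (H (th n k) / 2 *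
      (sl H (2 * Real.pi / n) (th n k) - sl H (-(2 * Real.pi / n)) (th n k))) := fun k => by
    unfold tri
    rw [hκ _ _ _ _ (hp _) (div_le_div_of_nonneg_right (hK.sl_le hs _) (hp _).le)]
    congr 2
    have := (hp (th n k)).ne'
    field_simp
  simp_rw [this]
  rw [← Finset.mul_sum, ← ENNReal.ofReal_sum_of_nonneg (fun k _ => mul_nonneg (by have := hp (th n k); positivity)
    (sub_nonneg.2 (hK.sl_le hs _)))]
  congr 2
  simp_rw [sl_len]
  have e1 : ∀ k, H (th n k + 2 * Real.pi / n) = H (th n (k + 1)) := fun k =>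
    (th_succ (by omega) hK.periodic k).symm
  have e2 : ∀ k, H (th n k - 2 * Real.pi / n) = H (th n (k - 1)) := fun k =>
    (th_pred (by omega) hK.periodic k).symm
  simp_rw [e1, e2]
  have e3 : ∑ k : ZMod n, H (th n k) * H (th n (k - 1)) = ∑ k : ZMod n, H (th n k) * H (th n (k + 1)) := by
    rw [← Equiv.sum_comp (Equiv.addRight (1 : ZMod n)) (fun j => H (th n j) * H (th n (j - 1)))]
    refine Finset.sum_congr rfl fun j _ => ?_
    simp [mul_comm]
  have e4 : ∀ k, H (th n k) / 2 * ((H (th n (k + 1)) + H (th n (k - 1)) - 2 * H (th n k) * Real.cos (2 * Real.pi / n)) /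
      Real.sin (2 * Real.pi / n)) = (H (th n k) * H (th n (k + 1)) / 2 + H (th n k) * H (th n (k - 1)) / 2 -
      Real.cos (2 * Real.pi / n) * (H (th n k) * H (th n k))) / Real.sin (2 * Real.pi / n) := fun k => by ring
  simp_rw [e4]
  rw [← Finset.sum_div, Finset.sum_sub_distrib, Finset.sum_add_distrib, ← Finset.sum_div, ← Finset.sum_div, e3,
    ← Finset.mul_sum]
  congr 1; ring

end

/-! ### Monotonicity of the perimeter -/

lemma exists_proj {K : Set Pl} (hKc : IsCompact K) (hconv : Convex ℝ K) (hne : K.Nonempty) (x : Pl) :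
    ∃ v ∈ K, ∀ w ∈ K, ⟪x - v, w - v⟫ ≤ 0 := by
  obtain ⟨v, hv, h⟩ := exists_norm_eq_iInf_of_complete_convex hne hKc.isComplete hconv x
  exact ⟨v, hv, (norm_eq_iInf_iff_real_inner_le_zero hconv hv).1 h⟩

lemma precon_frontier {s t : Set Pl} (hs : IsPreconnected s) (h1 : (s ∩ t).Nonempty)
    (h2 : (s ∩ tᶜ).Nonempty) : (s ∩ frontier t).Nonempty := by
  by_contra hc
  have hd : ∀ x ∈ s, x ∉ frontier t := fun x hx hf => hc ⟨x, hx, hf⟩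
  have a1 : ∀ x ∈ s, x ∈ closure t → x ∈ interior t :=
    fun x hx h => by_contra fun h' => hd x hx ⟨h, h'⟩
  obtain ⟨x, hx, hxt⟩ := h1
  obtain ⟨y, hy, hyt⟩ := h2
  obtain ⟨z, _, hz1, hz2⟩ := hs (interior t) (closure t)ᶜ isOpen_interior
    isClosed_closure.isOpen_compl
    (fun z hz => by
      by_cases h : z ∈ closure t
      · exact Or.inl (a1 z hz h)
      · exact Or.inr h)
    ⟨x, hx, a1 x hx (subset_closure hxt)⟩ ⟨y, hy, fun h => hyt (interior_subset (a1 y hy h))⟩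
  exact hz2 (subset_closure (interior_subset hz1))

lemma perimeter_mono {K M : Set Pl} (hKc : IsCompact K) (hconv : Convex ℝ K) (hKi : (interior K).Nonempty)
    (hM : Bornology.IsBounded M) (hKM : K ⊆ M) :
    μH[(1:ℝ)] (frontier K) ≤ μH[(1:ℝ)] (frontier M) := by
  have hne : K.Nonempty := hKi.mono interior_subset
  choose π hπ hπi using exists_proj hKc hconv hne
  have hlip : LipschitzWith 1 π := by
    refine LipschitzWith.of_dist_le_mul fun x y => ?_
    rw [NNReal.coe_one, one_mul, dist_eq_norm, dist_eq_norm]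
    have h1 := hπi x (π y) (hπ y)
    have h2 := hπi y (π x) (hπ x)
    set d := π x - π y with hd
    have e : ⟪x - y, d⟫ = ⟪d, d⟫ - ⟪x - π x, π y - π x⟫ - ⟪y - π y, π x - π y⟫ := by
      have e1 : π y - π x = -d := by rw [hd]; abel
      rw [e1, inner_neg_right, ← hd, sub_neg_eq_add, ← inner_add_left, ← inner_sub_left]
      congr 1; rw [hd]; abel
    have h3 : ‖d‖ * ‖d‖ ≤ ‖x - y‖ * ‖d‖ := by
      rw [← real_inner_self_eq_norm_mul_norm]
      have := real_inner_le_norm (x - y) d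
      linarith
    by_cases h0 : ‖d‖ = 0
    · rw [h0]; positivity
    · exact le_of_mul_le_mul_right h3 (lt_of_le_of_ne (norm_nonneg _) (Ne.symm h0))
  have hsub : frontier K ⊆ π '' frontier M := by
    intro y hy
    have hyK : y ∈ K := hKc.isClosed.frontier_subset hy
    obtain ⟨f, hf⟩ := geometric_hahn_banach_open_point hconv.interior isOpen_interior hy.2
    have hf' : ∀ w ∈ K, f w ≤ f y := by
      intro w hw
      have hw' : w ∈ closure (interior K) := by
        rw [hconv.closure_interior_eq_closure_of_nonempty_interior hKi]; exact subset_closure hw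
      have : closure (interior K) ⊆ {w | f w ≤ f y} :=
        closure_minimal (fun a ha => (hf a ha).le) (isClosed_le f.continuous continuous_const)
      exact this hw'
    set ν : Pl := (InnerProductSpace.toDual ℝ Pl).symm f with hν
    have hνf : ∀ w, ⟪ν, w⟫ = f w := fun w => by
      rw [hν, InnerProductSpace.toDual_symm_apply]
    have hν0 : ν ≠ 0 := by
      intro h0
      obtain ⟨a, ha⟩ := hKi
      have h1 := hf a ha
      rw [← hνf, ← hνf, h0] at h1
      simp at h1
    have hray : IsPreconnected ((fun t : ℝ => y + t • ν) '' Ici 0) :=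
      isPreconnected_Ici.image _ (by fun_prop)
    have h1 : (((fun t : ℝ => y + t • ν) '' Ici 0) ∩ M).Nonempty :=
      ⟨y, ⟨0, self_mem_Ici, by simp⟩, hKM hyK⟩
    have h2 : (((fun t : ℝ => y + t • ν) '' Ici 0) ∩ Mᶜ).Nonempty := by
      obtain ⟨R, hR⟩ := hM.exists_norm_le
      have hνp : 0 < ‖ν‖ := norm_pos_iff.2 hν0
      refine ⟨y + ((|R| + ‖y‖ + 1) / ‖ν‖) • ν, ⟨_, ?_, rfl⟩, fun hmem => ?_⟩
      · simp only [mem_Ici]; positivity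
      · have h3 := hR _ hmem
        have h4 : ‖((|R| + ‖y‖ + 1) / ‖ν‖) • ν‖ = |R| + ‖y‖ + 1 := by
          rw [norm_smul, Real.norm_of_nonneg (by positivity), div_mul_cancel₀ _ hνp.ne']
        have h5 := norm_sub_le (y + ((|R| + ‖y‖ + 1) / ‖ν‖) • ν) y
        rw [add_sub_cancel_left, h4] at h5
        have := le_abs_self R
        linarith
    obtain ⟨z, ⟨t, ht, rfl⟩, hz⟩ := precon_frontier hray h1 h2
    refine ⟨_, hz, ?_⟩
    simp only
    set z := y + t • ν with hzd
    have h3 := hπi z y hyK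
    have h4 : ⟪z - y, π z - y⟫ ≤ 0 := by
      rw [hzd, add_sub_cancel_left, real_inner_smul_left, hνf, map_sub]
      exact mul_nonpos_of_nonneg_of_nonpos ht (by linarith [hf' _ (hπ z)])
    have e : ⟪π z - y, π z - y⟫ = ⟪z - y, π z - y⟫ + ⟪z - π z, y - π z⟫ := by
      have e1 : y - π z = -(π z - y) := by abel
      rw [e1, inner_neg_right, ← sub_eq_add_neg, ← inner_sub_left]
      congr 1; abel
    have h5 : ⟪π z - y, π z - y⟫ ≤ 0 := by linarith
    rw [real_inner_self_nonpos] at h5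
    exact sub_eq_zero.1 h5
  calc μH[(1:ℝ)] (frontier K) ≤ μH[(1:ℝ)] (π '' frontier M) := measure_mono hsub
    _ ≤ (1 : NNReal) ^ (1:ℝ) * μH[(1:ℝ)] (frontier M) := by
        exact hlip.hausdorffMeasure_image_le zero_le_one _
    _ = μH[(1:ℝ)] (frontier M) := by simp

lemma inner_pt (φ p : ℝ) (x : Pl) : ⟪pt φ p 0, x⟫ = p * pr φ x := by
  simp [PiLp.inner_apply, pt, pr]; ring

lemma mem_of_supp {K : Set Pl} {H : ℝ → ℝ} (hK : IsSupp K H) (hKc : IsCompact K) (hconv : Convex ℝ K)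
    (hne : K.Nonempty) (x : Pl) (hx : ∀ φ, pr φ x ≤ H φ) : x ∈ K := by
  obtain ⟨v, hv, h⟩ := exists_proj hKc hconv hne x
  by_contra hxK
  have h0 : x - v ≠ 0 := fun h0 => hxK (by rwa [sub_eq_zero.1 h0])
  have hpos : 0 < ‖x - v‖ := norm_pos_iff.2 h0
  obtain ⟨φ, hφ⟩ := exists_angle (x - v)
  obtain ⟨w, hw, hw'⟩ := hK.2 φ
  have h1 := h w hw
  rw [hφ, inner_pt, pr_sub] at h1
  have h2 : pr φ (x - v) = ‖x - v‖ := by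
    conv_lhs => rw [hφ]
    rw [pr_pt]
  rw [pr_sub] at h2
  have h3 := hx φ
  nlinarith

lemma pr_lip (φ s : ℝ) (hs : 0 ≤ s) (hs2 : s ≤ 2) (x : Pl) : |pr (φ + s) x - pr φ x| ≤ 2 * ‖x‖ * s := by
  have e : prq φ x = pr (φ + Real.pi / 2) x := by rw [pr_add_angle]; simp
  have h1 := abs_pr_le φ x
  have h2 := abs_pr_le (φ + Real.pi / 2) x
  rw [← e] at h2
  have h3 : pr (φ + s) x - pr φ x = pr φ x * (Real.cos s - 1) + prq φ x * Real.sin s := by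
    rw [pr_add_angle]; ring
  rw [h3]
  refine (abs_add_le _ _).trans ?_
  rw [abs_mul, abs_mul]
  have h4 : |Real.cos s - 1| ≤ s := by
    rw [abs_le]
    have := Real.one_sub_sq_div_two_le_cos (x := s)
    have := Real.cos_le_one s
    constructor <;> nlinarith
  have h5 : |Real.sin s| ≤ s := by
    have := Real.abs_sin_le_abs (x := s)
    rwa [abs_of_nonneg hs] at this
  have := mul_le_mul h1 h4 (abs_nonneg _) (norm_nonneg _)
  have := mul_le_mul h2 h5 (abs_nonneg _) (norm_nonneg _)
  linarith

lemma near_angle (n : ℕ) [NeZero n] (φ : ℝ) : ∃ (k : ZMod n) (s : ℝ), 0 ≤ s ∧ s ≤ 2 * Real.pi / n ∧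
    ∀ g : ℝ → ℝ, Function.Periodic g (2 * Real.pi) → g φ = g (th n k + s) := by
  have hn : (0:ℝ) < n := by exact_mod_cast Nat.pos_of_ne_zero (NeZero.ne n)
  have hpi := Real.pi_pos
  set δ := 2 * Real.pi / n with hδ
  have hδ0 : 0 < δ := by positivity
  set m := ⌊φ / δ⌋ with hm
  refine ⟨(m : ZMod n), φ - m * δ, ?_, ?_, ?_⟩
  · have := Int.floor_le (φ / δ)
    rw [← hm, le_div_iff₀ hδ0] at this
    linarith
  · have := Int.lt_floor_add_one (φ / δ)
    rw [← hm, div_lt_iff₀ hδ0] at this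
    linarith
  · intro g hg
    have h1 : ((m : ZMod n).val : ℤ) = m % n := ZMod.val_intCast m
    have h2 := Int.emod_add_mul_ediv m n
    have h3 : (((m : ZMod n).val : ℕ) : ℝ) = m - n * ((m / n : ℤ) : ℝ) := by
      have : (((m : ZMod n).val : ℤ) : ℤ) = m - n * (m / n) := by rw [h1]; linarith
      exact_mod_cast this
    have h4 : φ = th n (m : ZMod n) + (φ - m * δ) + ((m / n : ℤ) : ℝ) * (2 * Real.pi) := by
      rw [th, h3, ← hδ]
      have : (n:ℝ) * δ = 2 * Real.pi := by rw [hδ]; field_simp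
      linear_combination ((m / n : ℤ) : ℝ) * this
    conv_lhs => rw [h4]
    exact hg.int_mul _ _

lemma poly_sub_smul {K : Set Pl} {H : ℝ → ℝ} (hK : IsSupp K H) (hKc : IsCompact K) (hconv : Convex ℝ K)
    {r : ℝ} (hr : 0 < r) (hb : Metric.closedBall 0 r ⊆ K) {ε : ℝ} (hε : 0 < ε) :
    ∀ᶠ n : ℕ in atTop, poly n H ⊆ (1 + ε) • K := by
  have hne : K.Nonempty := ⟨0, hb (by simp [hr.le])⟩
  obtain ⟨R, hR0, hR⟩ := hKc.isBounded.exists_pos_norm_le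
  have hpi := Real.pi_pos
  have hlim : Tendsto (fun n : ℕ => 2 * Real.pi / (n:ℝ)) atTop (nhds 0) :=
    tendsto_const_div_atTop_nhds_zero_nat _
  have hpos : 0 < ε * r / (6 * R) := by positivity
  filter_upwards [eventually_ge_atTop 6, hlim.eventually (gt_mem_nhds hpos)] with n hn6 hnε
  have : NeZero n := ⟨by omega⟩
  have hn6' : (6:ℝ) ≤ n := by exact_mod_cast hn6
  have hδ3 : 2 * Real.pi / (n:ℝ) ≤ Real.pi / 3 := by
    rw [div_le_div_iff₀ (by linarith) (by norm_num)]; nlinarith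
  have hpi4 := Real.pi_le_four
  rw [lt_div_iff₀ (by positivity)] at hnε
  intro x hx
  have hx2 : ‖x‖ ≤ 2 * R := by
    obtain ⟨φ, hφ⟩ := exists_angle x
    obtain ⟨k, s, hs0, hs, hg⟩ := near_angle n φ
    have h1 : pr (th n k) x = ‖x‖ * Real.cos s := by
      have hg' : Function.Periodic (fun t => pr (t - s) x) (2 * Real.pi) := fun t => by
        have := pr_periodic x (t - s)
        simp only at this ⊢
        rw [← this]; congr 1; ring
      have := hg _ hg'
      simp only [add_sub_cancel_right] at this
      rw [← this]
      conv_lhs => rw [hφ]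
      rw [sub_eq_add_neg, pr_add_angle, pr_pt, prq_pt]; simp
    have h2 : 1 / 2 ≤ Real.cos s := by
      rw [← Real.cos_pi_div_three]
      exact Real.cos_le_cos_of_nonneg_of_le_pi hs0 (by linarith) (by linarith)
    have h3 : H (th n k) ≤ R := by
      obtain ⟨y, hy, hy'⟩ := hK.2 (th n k)
      rw [← hy']
      exact (le_abs_self _).trans ((abs_pr_le _ _).trans (hR y hy))
    have h4 := hx k
    have := norm_nonneg x
    nlinarith
  have ht : (0:ℝ) < 1 + ε := by linarith
  rw [mem_smul_set_iff_inv_smul_mem₀ ht.ne']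
  apply mem_of_supp hK hKc hconv hne
  intro φ
  rw [pr_smul, inv_mul_le_iff₀ ht]
  obtain ⟨k, s, hs0, hs, hg⟩ := near_angle n φ
  have e1 := hg _ (pr_periodic x)
  have e2 := hg _ hK.periodic
  have h1 := (abs_le.1 (pr_lip (th n k) s hs0 (by linarith) x)).2
  obtain ⟨y, hy, hy'⟩ := hK.2 (th n k)
  have h2 := (abs_le.1 (pr_lip (th n k) s hs0 (by linarith) y)).1
  have h3 := hK.1 (th n k + s) y hy
  have h4 := hx k
  have h5 := hK.pos hr hb φ
  have h6 := hR y hy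
  rw [← e1] at h1
  rw [← e2] at h3
  have h7 : ‖x‖ * s ≤ 2 * R * s := mul_le_mul_of_nonneg_right hx2 hs0
  have h8 : ‖y‖ * s ≤ R * s := mul_le_mul_of_nonneg_right h6 hs0
  have h9 : R * s ≤ R * (2 * Real.pi / n) := mul_le_mul_of_nonneg_left hs hR0.le
  have h10 : ε * r ≤ ε * H φ := mul_le_mul_of_nonneg_left h5 hε.le
  nlinarith

/-! ### The main theorem -/

lemma frontier_smul_measure (K : Set Pl) {t : ℝ} (ht : 0 < t) :
    μH[(1:ℝ)] (frontier (t • K)) = ENNReal.ofReal t * μH[(1:ℝ)] (frontier K) := by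
  have e : frontier (t • K) = t • frontier K :=
    ((Homeomorph.smulOfNeZero t ht.ne').image_frontier K).symm
  rw [e, Measure.hausdorffMeasure_smul₀ zero_le_one ht.ne', ENNReal.smul_def, smul_eq_mul, NNReal.rpow_one]
  congr 1
  rw [← enorm_eq_nnnorm, Real.enorm_of_nonneg ht.le]

lemma smul_measure2 (K : Set Pl) {t : ℝ} (ht : 0 < t) :
    μH[(2:ℝ)] (t • K) = ENNReal.ofReal (t ^ 2) * μH[(2:ℝ)] K := by
  rw [Measure.hausdorffMeasure_smul₀ zero_le_two ht.ne', ENNReal.smul_def, smul_eq_mul]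
  congr 1
  rw [NNReal.rpow_two, ENNReal.coe_pow, ← enorm_eq_nnnorm, Real.enorm_of_nonneg ht.le,
    ENNReal.ofReal_pow ht.le]

lemma combine (κ AK AL AM PK PL PM : ℝ≥0∞) (aK aL aM SK SL s C t : ℝ)
    (ht : 0 < t) (hs : 0 < s) (hC : 0 < C) (hSK : 0 < SK) (hSL : 0 < SL)
    (haK : 0 ≤ aK) (haL : 0 ≤ aL)
    (hd : aK / SK + aL / SL ≤ aM / (SK + SL))
    (hAK : AK ≤ κ * ENNReal.ofReal (aK / s)) (hAL : AL ≤ κ * ENNReal.ofReal (aL / s))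
    (hAM : κ * ENNReal.ofReal (aM / s) ≤ ENNReal.ofReal (t ^ 2) * AM)
    (hPK : ENNReal.ofReal (C * SK) ≤ ENNReal.ofReal t * PK)
    (hPL : ENNReal.ofReal (C * SL) ≤ ENNReal.ofReal t * PL)
    (hPM : PM ≤ ENNReal.ofReal (C * (SK + SL))) :
    AK / PK + AL / PL ≤ ENNReal.ofReal (t ^ 3) * (AM / PM) := by
  have key : ∀ (A P : ℝ≥0∞) (a S : ℝ), 0 < S → A ≤ κ * ENNReal.ofReal (a / s) →
      ENNReal.ofReal (C * S) ≤ ENNReal.ofReal t * P →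
      A / P ≤ κ * ENNReal.ofReal (t / (s * C) * (a / S)) := by
    intro A P a S hS h1 h2
    have h3 : ENNReal.ofReal (C * S / t) ≤ P := by
      rw [ENNReal.ofReal_div_of_pos ht]
      exact ENNReal.div_le_of_le_mul' h2
    calc A / P ≤ κ * ENNReal.ofReal (a / s) / ENNReal.ofReal (C * S / t) := ENNReal.div_le_div h1 h3
      _ = κ * ENNReal.ofReal (a / s / (C * S / t)) := by
        rw [mul_div_assoc, ← ENNReal.ofReal_div_of_pos (show 0 < C * S / t by positivity)]
      _ = _ := by congr 2; field_simp
  have kM : κ * ENNReal.ofReal (t / (s * C) * (aM / (SK + SL))) ≤ ENNReal.ofReal (t ^ 3) * (AM / PM) := by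
    calc κ * ENNReal.ofReal (t / (s * C) * (aM / (SK + SL)))
        = ENNReal.ofReal t * (κ * ENNReal.ofReal (aM / s) / ENNReal.ofReal (C * (SK + SL))) := by
          rw [mul_div_assoc, ← ENNReal.ofReal_div_of_pos (by positivity), mul_left_comm,
            ← ENNReal.ofReal_mul ht.le]
          congr 2; field_simp
      _ ≤ ENNReal.ofReal t * (ENNReal.ofReal (t ^ 2) * AM / PM) := by
          gcongr
      _ = _ := by
          rw [mul_div_assoc, ← mul_assoc, ← ENNReal.ofReal_mul ht.le]
          congr 2; ring
  calc AK / PK + AL / PL ≤ κ * ENNReal.ofReal (t / (s * C) * (aK / SK)) +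
        κ * ENNReal.ofReal (t / (s * C) * (aL / SL)) :=
        add_le_add (key _ _ _ _ hSK hAK hPK) (key _ _ _ _ hSL hAL hPL)
    _ = κ * ENNReal.ofReal (t / (s * C) * (aK / SK + aL / SL)) := by
        rw [← mul_add, ← ENNReal.ofReal_add (by positivity) (by positivity), mul_add]
    _ ≤ κ * ENNReal.ofReal (t / (s * C) * (aM / (SK + SL))) := by
        gcongr
    _ ≤ _ := kM

lemma exists_ball {K : Set Pl} (h : (0 : Pl) ∈ interior K) : ∃ r > 0, Metric.closedBall (0 : Pl) r ⊆ K := by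
  obtain ⟨r, hr, hb⟩ := Metric.nhds_basis_closedBall.mem_iff.1 (mem_interior_iff_mem_nhds.1 h)
  exact ⟨r, hr, hb⟩

lemma main0 (K L : Set Pl)
    (hKc : IsCompact K) (hKconv : Convex ℝ K) (hKint : (0 : Pl) ∈ interior K)
    (hLc : IsCompact L) (hLconv : Convex ℝ L) (hLint : (0 : Pl) ∈ interior L) :
    μH[(2 : ℝ)] K / μH[(1 : ℝ)] (frontier K) + μH[(2 : ℝ)] L / μH[(1 : ℝ)] (frontier L) ≤
      μH[(2 : ℝ)] (K + L) / μH[(1 : ℝ)] (frontier (K + L)) := by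
  have := haar2
  have hMc := hKc.add hLc
  have hMconv := hKconv.add hLconv
  have hMsub : K ⊆ K + L := fun x hx => ⟨x, hx, 0, interior_subset hLint, add_zero x⟩
  have hMint : (0 : Pl) ∈ interior (K + L) := interior_mono hMsub hKint
  obtain ⟨rK, hrK, hbK⟩ := exists_ball hKint
  obtain ⟨rL, hrL, hbL⟩ := exists_ball hLint
  obtain ⟨rM, hrM, hbM⟩ := exists_ball hMint
  obtain ⟨H, hH⟩ := exists_supp K hKc ⟨0, interior_subset hKint⟩
  obtain ⟨G, hG⟩ := exists_supp L hLc ⟨0, interior_subset hLint⟩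
  have hHG := hH.add hG
  have hHp : ∀ φ, 0 < H φ := fun φ => hrK.trans_le (hH.pos hrK hbK φ)
  have hGp : ∀ φ, 0 < G φ := fun φ => hrL.trans_le (hG.pos hrL hbL φ)
  have hHGp : ∀ φ, 0 < H φ + G φ := fun φ => add_pos (hHp φ) (hGp φ)
  obtain ⟨κ, hκ0, hκt, hκ⟩ := measure_tri
  have hkey : ∀ ε : ℝ, 0 < ε →
      μH[(2 : ℝ)] K / μH[(1 : ℝ)] (frontier K) + μH[(2 : ℝ)] L / μH[(1 : ℝ)] (frontier L) ≤
      ENNReal.ofReal ((1 + ε) ^ 3) * (μH[(2 : ℝ)] (K + L) / μH[(1 : ℝ)] (frontier (K + L))) := by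
    intro ε hε
    obtain ⟨n, hn, h1, h2, h3⟩ := ((eventually_ge_atTop 3).and
      ((poly_sub_smul hH hKc hKconv hrK hbK hε).and
      ((poly_sub_smul hG hLc hLconv hrL hbL hε).and
      (poly_sub_smul hHG hMc hMconv hrM hbM hε)))).exists
    have hnz : NeZero n := ⟨by omega⟩
    have ht : 0 < 1 + ε := by linarith
    obtain ⟨hs, -⟩ := sin_pos_n hn
    have hC : 0 < (2 - 2 * Real.cos (2 * Real.pi / n)) / Real.sin (2 * Real.pi / n) := by
      apply div_pos _ hs
      have := Real.sin_sq_add_cos_sq (2 * Real.pi / n)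
      nlinarith
    -- perimeter
    have per : ∀ {K : Set Pl} {H : ℝ → ℝ}, IsSupp K H → (∀ φ, 0 < H φ) → IsCompact K → Convex ℝ K →
        (0 : Pl) ∈ interior K → poly n H ⊆ (1 + ε) • K →
        μH[(1:ℝ)] (frontier K) ≤ ENNReal.ofReal ((2 - 2 * Real.cos (2 * Real.pi / n)) /
          Real.sin (2 * Real.pi / n) * ∑ k : ZMod n, H (th n k)) ∧
        ENNReal.ofReal ((2 - 2 * Real.cos (2 * Real.pi / n)) /
          Real.sin (2 * Real.pi / n) * ∑ k : ZMod n, H (th n k)) ≤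
          ENNReal.ofReal (1 + ε) * μH[(1:ℝ)] (frontier K) := by
      intro K H hK hp hc hconv hKi hsub
      have hbK : Bornology.IsBounded ((1 + ε) • K) := (hc.smul (1 + ε)).isBounded
      have hbp : Bornology.IsBounded (poly n H) := hbK.subset hsub
      rw [← measure_frontier_poly hK hp hn, ← frontier_smul_measure K ht]
      constructor
      · exact perimeter_mono hc hconv ⟨0, hKi⟩ hbp (sub_poly hK)
      · exact perimeter_mono (Metric.isCompact_of_isClosed_isBounded isClosed_poly hbp) convex_poly
          ⟨0, interior_mono (sub_poly hK) hKi⟩ hbK hsub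
    have pos2 : ∀ {K : Set Pl}, (0 : Pl) ∈ interior K → 0 < μH[(2:ℝ)] K := fun hKi =>
      Measure.measure_pos_of_nonempty_interior _ ⟨0, hKi⟩
    have apos : ∀ {K : Set Pl} {a : ℝ}, (0 : Pl) ∈ interior K →
        μH[(2:ℝ)] K ≤ κ * ENNReal.ofReal (a / Real.sin (2 * Real.pi / n)) → 0 ≤ a := by
      intro K a hKi h
      have h4 := (pos2 hKi).trans_le h
      by_contra hneg
      push Not at hneg
      rw [ENNReal.ofReal_of_nonpos (div_nonpos_of_nonpos_of_nonneg hneg.le hs.le), mul_zero] at h4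
      exact lt_irrefl _ h4
    have areaK := measure_poly hH hHp hn κ hκ
    have areaL := measure_poly hG hGp hn κ hκ
    have areaM := measure_poly hHG hHGp hn κ hκ
    have aK := (measure_mono (sub_poly (n := n) hH)).trans areaK.le
    have aL := (measure_mono (sub_poly (n := n) hG)).trans areaL.le
    have aM := areaM.ge.trans (measure_mono h3)
    rw [smul_measure2 _ ht] at aM
    have pK := per hH hHp hKc hKconv hKint h1
    have pL := per hG hGp hLc hLconv hLint h2
    have pM := per hHG hHGp hMc hMconv hMint h3
    have SK : 0 < ∑ k : ZMod n, H (th n k) := Finset.sum_pos (fun k _ => hHp _) Finset.univ_nonempty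
    have SL : 0 < ∑ k : ZMod n, G (th n k) := Finset.sum_pos (fun k _ => hGp _) Finset.univ_nonempty
    have hd := discrete_claim n (fun k => H (th n k)) (fun k => G (th n k)) SK SL _ (fun f => rfl)
    have pM1 := pM.1
    rw [Finset.sum_add_distrib] at pM1 hd
    exact combine κ _ _ _ _ _ _ _ _ _ _ _ _ _ _ ht hs hC SK SL (apos hKint aK) (apos hLint aL) hd aK aL aM
      pK.2 pL.2 pM1
  have hlim : Tendsto (fun ε : ℝ => ENNReal.ofReal ((1 + ε) ^ 3) *
      (μH[(2 : ℝ)] (K + L) / μH[(1 : ℝ)] (frontier (K + L)))) (nhdsWithin 0 (Ioi 0))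
      (nhds (1 * (μH[(2 : ℝ)] (K + L) / μH[(1 : ℝ)] (frontier (K + L))))) := by
    refine ENNReal.Tendsto.mul_const ?_ (Or.inl one_ne_zero)
    have hc : Continuous (fun ε : ℝ => ENNReal.ofReal ((1 + ε) ^ 3)) :=
      ENNReal.continuous_ofReal.comp (by fun_prop)
    have := hc.tendsto 0
    simp only [add_zero, one_pow, ENNReal.ofReal_one] at this
    exact this.mono_left nhdsWithin_le_nhds
  rw [one_mul] at hlim
  exact ge_of_tendsto hlim (eventually_nhdsWithin_of_forall fun ε hε => hkey ε hε)

lemma translate_measure (K : Set Pl) (a : Pl) (d : ℝ) :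
    μH[d] ((fun x => x - a) '' K) = μH[d] K ∧
    μH[d] (frontier ((fun x => x - a) '' K)) = μH[d] (frontier K) ∧
    interior ((fun x => x - a) '' K) = (fun x => x - a) '' interior K := by
  have e : ∀ s : Set Pl, (IsometryEquiv.subRight a) '' s = (fun x => x - a) '' s := fun s => rfl
  refine ⟨?_, ?_, ?_⟩
  · rw [← e, IsometryEquiv.hausdorffMeasure_image]
  · rw [← e, ← IsometryEquiv.hausdorffMeasure_image (IsometryEquiv.subRight a) d (frontier K)]
    congr 1
    exact ((IsometryEquiv.subRight a).toHomeomorph.image_frontier K).symm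
  · exact ((IsometryEquiv.subRight a).toHomeomorph.image_interior K).symm

theorem stmt16
    (K L : Set (EuclideanSpace ℝ (Fin 2)))
    (hKc : IsCompact K) (hKconv : Convex ℝ K) (hKint : (interior K).Nonempty)
    (hLc : IsCompact L) (hLconv : Convex ℝ L) (hLint : (interior L).Nonempty) :
    μH[(2 : ℝ)] K / μH[(1 : ℝ)] (frontier K) + μH[(2 : ℝ)] L / μH[(1 : ℝ)] (frontier L) ≤
      μH[(2 : ℝ)] (K + L) / μH[(1 : ℝ)] (frontier (K + L)) := by
  obtain ⟨a, ha⟩ := hKint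
  obtain ⟨b, hb⟩ := hLint
  have e : (fun x => x - a) '' K + (fun x => x - b) '' L = (fun x => x - (a + b)) '' (K + L) := by
    ext z; constructor
    · rintro ⟨_, ⟨x, hx, rfl⟩, _, ⟨y, hy, rfl⟩, rfl⟩
      exact ⟨x + y, ⟨x, hx, y, hy, rfl⟩, by simp only; abel⟩
    · rintro ⟨_, ⟨x, hx, y, hy, rfl⟩, rfl⟩
      exact ⟨x - a, ⟨x, hx, rfl⟩, y - b, ⟨y, hy, rfl⟩, by simp only; abel⟩
  have conv : ∀ (M : Set Pl) (c : Pl), Convex ℝ M → Convex ℝ ((fun x => x - c) '' M) := by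
    intro M c hM
    have := hM.translate (-c)
    simpa [sub_eq_add_neg, add_comm] using this
  have h := main0 ((fun x => x - a) '' K) ((fun x => x - b) '' L)
    (hKc.image (by fun_prop)) (conv K a hKconv) (by
      rw [(translate_measure K a 1).2.2]; exact ⟨a, ha, sub_self a⟩)
    (hLc.image (by fun_prop)) (conv L b hLconv) (by
      rw [(translate_measure L b 1).2.2]; exact ⟨b, hb, sub_self b⟩)
  rw [e, (translate_measure K a 2).1, (translate_measure L b 2).1, (translate_measure (K + L) (a + b) 2).1,
    (translate_measure K a 1).2.1, (translate_measure L b 1).2.1, (translate_measure (K + L) (a + b) 1).2.1] at h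
  exact h
end
end
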